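/- (Recovery sequences in the subcritical regime, Theorem 5.6, laminate case A' ≠ B'.) Assume W is continuous and satisfies (H1)–(H4) and the normalization of the wells with a ≠ 0. Let (u, b) be the laminate configuration with interfaces α₁ < ⋯ < α_m, and let h_n → 0⁺, ε_n → 0⁺ be arbitrary sequences with h_n/ε_n → 0. Then there exists a sequence of maps u_n : ℝ³ → ℝ³, each C¹ with Lipschitz differential (so that second partial derivatives exist a.e. and F^{h_n}_{ε_n}(u_n, Ω) is defined using these a.e. second derivatives), such that ∫_Ω (|u_n − u|^p + |∂₁u_n(x) − ū'(x₁)|^p + |∂₂u_n|^p) dx → 0, ∫_Ω |h_n⁻¹∂₃u_n − b|^p dx → 0, and lim_{n→∞} F^{h_n}_{ε_n}(u_n, Ω) = K₀ · Σ_{i=1}^m ℒ¹(J_i). -/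

import Mathlib

open MeasureTheory Filter Topology ENNReal NNReal Set

noncomputable section

/-- Vectors in ℝ³. -/
abbrev V3 := Fin 3 → ℝ

/-- 3×3 matrices, represented as the triple of their columns. -/
abbrev M33 := Fin 3 → V3

/-- Euclidean norm on ℝ³. -/
def vnorm (v : V3) : ℝ := Real.sqrt (∑ i, (v i) ^ 2)

/-- Frobenius (Euclidean) norm on 3×3 matrices. -/
def mnorm (ξ : M33) : ℝ := Real.sqrt (∑ j, ∑ i, (ξ j i) ^ 2)

/-- dist(ξ,{A,B}). -/
def mdist (A B ξ : M33) : ℝ := min (mnorm (ξ - A)) (mnorm (ξ - B))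

/-- Spatial points of ℝ³ = ℝ × ℝ × ℝ. -/
abbrev Pt := ℝ × ℝ × ℝ

/-- Directional partial derivative of a map `u : ℝ³ → ℝ³`. -/
def pd (e : Pt) (u : Pt → V3) (x : Pt) : V3 := fderiv ℝ u x e

def e1 : Pt := (1, 0, 0)
def e2 : Pt := (0, 1, 0)
def e3 : Pt := (0, 0, 1)

/-- Rescaled gradient ∇_h u = (∂₁u, ∂₂u, h⁻¹ ∂₃u), as a 3×3 matrix of columns. -/
def gradh (h : ℝ) (u : Pt → V3) (x : Pt) : M33 :=
  ![pd e1 u x, pd e2 u x, h⁻¹ • pd e3 u x]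

/-- Squared rescaled Hessian |∇²_h u|². -/
def hessh (h : ℝ) (u : Pt → V3) (x : Pt) : ℝ :=
  (vnorm (pd e1 (pd e1 u) x)) ^ 2 + (vnorm (pd e2 (pd e2 u) x)) ^ 2
    + (h⁻¹) ^ 4 * (vnorm (pd e3 (pd e3 u) x)) ^ 2
    + 2 * (vnorm (pd e2 (pd e1 u) x)) ^ 2
    + 2 * (h⁻¹) ^ 2 * (vnorm (pd e3 (pd e1 u) x)) ^ 2
    + 2 * (h⁻¹) ^ 2 * (vnorm (pd e3 (pd e2 u) x)) ^ 2

/-- The energy F^h_ε(u, S) = ∫_S (1/ε) W(∇_h u) + ε |∇²_h u|², valued in [0,∞]. -/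
def F (W : M33 → ℝ) (h ε : ℝ) (u : Pt → V3) (S : Set Pt) : ℝ≥0∞ :=
  ∫⁻ x in S, ENNReal.ofReal (ε⁻¹ * W (gradh h u x) + ε * hessh h u x)

/-- Hypothesis (H1): W ≥ 0, {W = 0} = {A, B}, A ≠ B, and A' − B' = 2 a ⊗ ν̄ for
some a ∈ ℝ³ and a unit vector ν̄ ∈ ℝ². -/
def H1 (W : M33 → ℝ) (A B : M33) : Prop :=
  (∀ ξ, 0 ≤ W ξ) ∧ (∀ ξ, W ξ = 0 ↔ ξ = A ∨ ξ = B) ∧ A ≠ B ∧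
    ∃ (a : V3) (ν : ℝ × ℝ), ν.1 ^ 2 + ν.2 ^ 2 = 1 ∧
      A 0 - B 0 = (2 * ν.1) • a ∧ A 1 - B 1 = (2 * ν.2) • a

/-- Hypothesis (H2): p-growth from above and below. -/
def H2 (W : M33 → ℝ) (p : ℝ) : Prop :=
  ∃ C > (0 : ℝ), ∀ ξ, C⁻¹ * (mnorm ξ) ^ p - C ≤ W ξ ∧ W ξ ≤ C * (mnorm ξ) ^ p + C

/-- Hypothesis (H3): non-degeneracy near the wells. -/
def H3 (W : M33 → ℝ) (A B : M33) (p : ℝ) : Prop :=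
  ∃ ϱ > (0 : ℝ), ∃ C > (0 : ℝ), ∀ ξ, mdist A B ξ ≤ ϱ →
    C⁻¹ * (mdist A B ξ) ^ p ≤ W ξ ∧ W ξ ≤ C * (mdist A B ξ) ^ p

/-- Hypothesis (H4): W(ξ₁, 0, ξ₃) ≤ W(ξ). -/
def H4 (W : M33 → ℝ) : Prop := ∀ ξ : M33, W ![ξ 0, 0, ξ 2] ≤ W ξ

/-- Normalization of the wells: A = −B, first column of A is a, second column is 0. -/
def Wells (A B : M33) (a : V3) : Prop := A = -B ∧ A 0 = a ∧ A 1 = 0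

/-- ū₀(t) = |t| a. -/
def ub0 (a : V3) (t : ℝ) : V3 := |t| • a

/-- b̄₀(t) = A₃ for t ≥ 0, −A₃ (= B₃) for t < 0. -/
def bb0 (A3 : V3) (t : ℝ) : V3 := if 0 ≤ t then A3 else -A3

/-- u₀(x) = ū₀(x₁). -/
def u0 (a : V3) (x : Pt) : V3 := ub0 a x.1

/-- b₀(x) = b̄₀(x₁). -/
def b0 (A3 : V3) (x : Pt) : V3 := bb0 A3 x.1

/-- The interval I = (−1/2, 1/2). -/
def II : Set ℝ := Set.Ioo (-(1 / 2 : ℝ)) (1 / 2)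

/-- The unit cube Q = I × I × I. -/
def Q3 : Set Pt := II ×ˢ (II ×ˢ II)

/-- J_ρ = (ρ I) × J × I. -/
def Jrho (J : Set ℝ) (ρ : ℝ) : Set Pt := (Set.Ioo (-(ρ / 2)) (ρ / 2)) ×ˢ (J ×ˢ II)

/-- The rescaled thin domain Ω = ω × I. -/
def Om (ω : Set (ℝ × ℝ)) : Set Pt := {x | (x.1, x.2.1) ∈ ω ∧ x.2.2 ∈ II}

/-- L¹ convergence on a set U. -/
def TendsL1 (U : Set Pt) (f : ℕ → Pt → V3) (g : Pt → V3) : Prop :=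
  Tendsto (fun n => ∫⁻ x in U, ENNReal.ofReal (vnorm (f n x - g x))) atTop (nhds 0)

/-- L^q convergence on a set U. -/
def TendsLp (U : Set Pt) (q : ℝ) (f : ℕ → Pt → V3) (g : Pt → V3) : Prop :=
  Tendsto (fun n => ∫⁻ x in U, ENNReal.ofReal ((vnorm (f n x - g x)) ^ q)) atTop (nhds 0)

/-- The localized asymptotic energy 𝓔_γ(J, ρ). -/
def Egam (W : M33 → ℝ) (a A3 : V3) (γ : ℝ) (J : Set ℝ) (ρ : ℝ) : ℝ≥0∞ :=
  sInf { L : ℝ≥0∞ | ∃ (h ε : ℕ → ℝ) (u : ℕ → Pt → V3),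
    (∀ n, 0 < h n) ∧ (∀ n, 0 < ε n) ∧
    Tendsto h atTop (nhds 0) ∧ Tendsto ε atTop (nhds 0) ∧
    Tendsto (fun n => h n / ε n) atTop (nhds γ) ∧
    (∀ n, ContDiffOn ℝ 2 (u n) (Jrho J ρ)) ∧
    TendsL1 (Jrho J ρ) u (u0 a) ∧
    TendsL1 (Jrho J ρ) (fun n x => (h n)⁻¹ • pd e3 (u n) x) (b0 A3) ∧
    L = Filter.liminf (fun n => F W (h n) (ε n) (u n) (Jrho J ρ)) atTop }

/-- K*_γ = 𝓔_γ(I, 1). -/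
def Kstar (W : M33 → ℝ) (a A3 : V3) (γ : ℝ) : ℝ≥0∞ := Egam W a A3 γ II 1

/-- K*_∞ : the analogue of K*_γ for h/ε → ∞, on the unit cube Q. -/
def KstarInf (W : M33 → ℝ) (a A3 : V3) : ℝ≥0∞ :=
  sInf { L : ℝ≥0∞ | ∃ (h ε : ℕ → ℝ) (u : ℕ → Pt → V3),
    (∀ n, 0 < h n) ∧ (∀ n, 0 < ε n) ∧
    Tendsto h atTop (nhds 0) ∧ Tendsto ε atTop (nhds 0) ∧
    Tendsto (fun n => h n / ε n) atTop atTop ∧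
    (∀ n, ContDiffOn ℝ 2 (u n) Q3) ∧
    TendsL1 Q3 u (u0 a) ∧
    TendsL1 Q3 (fun n x => (h n)⁻¹ • pd e3 (u n) x) (b0 A3) ∧
    L = Filter.liminf (fun n => F W (h n) (ε n) (u n) Q3) atTop }

open Classical in
/-- The phase matrix: B on E, A off E. -/
def Mfun (A B : M33) (E : Set (ℝ × ℝ)) (x' : ℝ × ℝ) : M33 := if x' ∈ E then B else A

/-! ### Two-dimensional objects -/

abbrev Pt2 := ℝ × ℝ

/-- Directional partial derivative of a map `v : ℝ² → ℝ³`. -/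
def qd (e : Pt2) (v : Pt2 → V3) (y : Pt2) : V3 := fderiv ℝ v y e

def f1 : Pt2 := (1, 0)
def f2 : Pt2 := (0, 1)

/-- 𝒲(∇v) = W(∂₁v, 0, ∂₂v). -/
def W2 (W : M33 → ℝ) (v : Pt2 → V3) (y : Pt2) : ℝ := W ![qd f1 v y, 0, qd f2 v y]

/-- Squared 2D Hessian |∇²v|². -/
def hess2d (v : Pt2 → V3) (y : Pt2) : ℝ :=
  (vnorm (qd f1 (qd f1 v) y)) ^ 2 + 2 * (vnorm (qd f2 (qd f1 v) y)) ^ 2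
    + (vnorm (qd f2 (qd f2 v) y)) ^ 2

/-- The rectangle ℓI × γI. -/
def Rect (ℓ γ : ℝ) : Set Pt2 := Set.Ioo (-(ℓ / 2)) (ℓ / 2) ×ˢ Set.Ioo (-(γ / 2)) (γ / 2)

/-- The optimal-profile constant K_γ of the critical regime. -/
def Kgam (W : M33 → ℝ) (a A3 : V3) (γ : ℝ) : ℝ≥0∞ :=
  sInf { L : ℝ≥0∞ | ∃ ℓ > (0 : ℝ), ∃ v : Pt2 → V3,
    ContDiffOn ℝ 2 v (Rect ℓ γ) ∧
    (∃ δ > (0 : ℝ), ∀ y ∈ Rect ℓ γ, ℓ / 2 - δ < y.1 → qd f1 v y = a ∧ qd f2 v y = A3) ∧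
    (∃ δ > (0 : ℝ), ∀ y ∈ Rect ℓ γ, y.1 < -(ℓ / 2) + δ → qd f1 v y = -a ∧ qd f2 v y = -A3) ∧
    L = ENNReal.ofReal γ⁻¹ *
      ∫⁻ y in Rect ℓ γ, ENNReal.ofReal (W2 W v y + hess2d v y) }

/-- The 2D subcritical functional F⁰_ε(u, b, D). -/
def F0 (W : M33 → ℝ) (ε : ℝ) (u b : Pt2 → V3) (D : Set Pt2) : ℝ≥0∞ :=
  ∫⁻ y in D, ENNReal.ofReal (ε⁻¹ * W ![qd f1 u y, qd f2 u y, b y]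
    + ε * ((vnorm (qd f1 (qd f1 u) y)) ^ 2 + 2 * (vnorm (qd f2 (qd f1 u) y)) ^ 2
      + (vnorm (qd f2 (qd f2 u) y)) ^ 2
      + 2 * (vnorm (qd f1 b y)) ^ 2 + 2 * (vnorm (qd f2 b y)) ^ 2))

/-- K*₀: the subcritical cell constant. -/
def Kstar0 (W : M33 → ℝ) (a A3 : V3) : ℝ≥0∞ :=
  sInf { L : ℝ≥0∞ | ∃ (ε : ℕ → ℝ) (u b : ℕ → Pt2 → V3),
    (∀ n, 0 < ε n) ∧ Tendsto ε atTop (nhds 0) ∧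
    (∀ n, ContDiffOn ℝ 2 (u n) (II ×ˢ II)) ∧ (∀ n, ContDiffOn ℝ 1 (b n) (II ×ˢ II)) ∧
    Tendsto (fun n => ∫⁻ y in II ×ˢ II,
      ENNReal.ofReal (vnorm (u n y - ub0 a y.1) + vnorm (b n y - bb0 A3 y.1)))
      atTop (nhds 0) ∧
    L = Filter.liminf (fun n => F0 W (ε n) (u n) (b n) (II ×ˢ II)) atTop }

/-- K₀: the subcritical optimal-profile constant. -/
def K0 (W : M33 → ℝ) (a A3 : V3) : ℝ≥0∞ :=
  sInf { L : ℝ≥0∞ | ∃ ℓ > (0 : ℝ), ∃ φ1 φ2 : ℝ → V3,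
    ContDiffOn ℝ 1 φ1 (Set.Icc (-ℓ) ℓ) ∧ ContDiffOn ℝ 1 φ2 (Set.Icc (-ℓ) ℓ) ∧
    φ1 ℓ = a ∧ φ2 ℓ = A3 ∧ φ1 (-ℓ) = -a ∧ φ2 (-ℓ) = -A3 ∧
    L = ∫⁻ t in Set.Ioo (-ℓ) ℓ, ENNReal.ofReal (W ![φ1 t, 0, φ2 t]
      + (vnorm (derivWithin φ1 (Set.Icc (-ℓ) ℓ) t)) ^ 2
      + 2 * (vnorm (derivWithin φ2 (Set.Icc (-ℓ) ℓ) t)) ^ 2) }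

/-- K_∞ in the case λ = 0. -/
def KinfZero (W : M33 → ℝ) (a : V3) : ℝ≥0∞ :=
  sInf { L : ℝ≥0∞ | ∃ ℓ > (0 : ℝ), ∃ v : Pt2 → V3,
    ContDiff ℝ 2 v ∧ (∀ y : Pt2, v (y.1, y.2 + 1) = v y) ∧
    (∃ δ > (0 : ℝ), ∀ y : Pt2, |y.1 - 1 / 2| < δ → qd f1 v y = a ∧ qd f2 v y = 0) ∧
    (∃ δ > (0 : ℝ), ∀ y : Pt2, |y.1 + 1 / 2| < δ → qd f1 v y = -a ∧ qd f2 v y = 0) ∧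
    L = ∫⁻ y in II ×ˢ II, ENNReal.ofReal (ℓ * W2 W v y + ℓ⁻¹ * hess2d v y) }

/-- The unit normal ν_λ = (1+λ²)^{-1/2} (1, λ). -/
def nuv (lam : ℝ) : Pt2 := (1 / Real.sqrt (1 + lam ^ 2), lam / Real.sqrt (1 + lam ^ 2))

/-- The orthogonal direction ν_λ^⊥ = (1+λ²)^{-1/2} (−λ, 1). -/
def nupv (lam : ℝ) : Pt2 := (-lam / Real.sqrt (1 + lam ^ 2), 1 / Real.sqrt (1 + lam ^ 2))

/-- Dot product on ℝ². -/
def dotp (w y : Pt2) : ℝ := w.1 * y.1 + w.2 * y.2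

/-- The unit square Q'_λ centered at 0 with two sides orthogonal to ν_λ. -/
def Qlam (lam : ℝ) : Set Pt2 := {y | |dotp (nuv lam) y| < 1 / 2 ∧ |dotp (nupv lam) y| < 1 / 2}

/-- K_∞ for general λ. -/
def KinfL (W : M33 → ℝ) (a : V3) (lam : ℝ) : ℝ≥0∞ :=
  ENNReal.ofReal (Real.sqrt (1 + lam ^ 2)) *
    sInf { L : ℝ≥0∞ | ∃ ℓ > (0 : ℝ), ∃ v : Pt2 → V3,
      ContDiff ℝ 2 v ∧ (∀ y : Pt2, v (y + nupv lam) = v y) ∧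
      (∃ δ > (0 : ℝ), ∀ y : Pt2, |dotp (nuv lam) y - 1 / 2| < δ →
        qd f1 v y = a ∧ qd f2 v y = lam • a) ∧
      (∃ δ > (0 : ℝ), ∀ y : Pt2, |dotp (nuv lam) y + 1 / 2| < δ →
        qd f1 v y = -a ∧ qd f2 v y = -(lam • a)) ∧
      L = ∫⁻ y in Qlam lam, ENNReal.ofReal (ℓ * W2 W v y + ℓ⁻¹ * hess2d v y) }

/-- Number of interfaces strictly below t. -/
def cnt (m : ℕ) (α : Fin m → ℝ) (t : ℝ) : ℕ := (Finset.univ.filter (fun i => α i < t)).card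

end

/-- The Steklov mean `δ⁻¹ ∫ₜ^{t+δ} f`. -/
noncomputable def steklov (δ : ℝ) (f : ℝ → V3) (t : ℝ) : V3 := δ⁻¹ • ∫ s in t..t + δ, f s

/-- `Φ` joins `-e` to `e` inside `[-ℓ, ℓ]` and is constant elsewhere. -/
structure IsTransition (Φ : ℝ → V3) (e : V3) (ℓ : ℝ) : Prop where
  right : ∀ t, ℓ ≤ t → Φ t = e
  left : ∀ t, t ≤ -ℓ → Φ t = -e

/-- The energy of a profile on the whole line. -/
noncomputable def profileEnergy (W : M33 → ℝ) (φ₁ φ₂ : ℝ → V3) : ℝ≥0∞ :=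
  ∫⁻ t, ENNReal.ofReal (W ![φ₁ t, 0, φ₂ t]
    + vnorm (deriv φ₁ t) ^ 2 + 2 * vnorm (deriv φ₂ t) ^ 2)

theorem vnorm_nonneg (v : V3) : 0 ≤ vnorm v := Real.sqrt_nonneg _

theorem vnorm_zero : vnorm 0 = 0 := by simp [vnorm]

theorem continuous_vnorm : Continuous vnorm := by
  unfold vnorm; fun_prop

theorem vnorm_smul (c : ℝ) (v : V3) : vnorm (c • v) = |c| * vnorm v := by
  unfold vnorm
  simp only [Pi.smul_apply, smul_eq_mul, mul_pow]
  rw [← Finset.mul_sum, Real.sqrt_mul (sq_nonneg c), Real.sqrt_sq_eq_abs]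

theorem vnorm_le (v : V3) : vnorm v ≤ 2 * ‖v‖ := by
  unfold vnorm
  rw [Real.sqrt_le_left (by positivity)]
  have hv : ∀ i, v i ^ 2 ≤ ‖v‖ ^ 2 := fun i => by
    rw [← sq_abs (v i)]
    exact pow_le_pow_left₀ (abs_nonneg _) (norm_le_pi_norm v i) 2
  calc ∑ i, v i ^ 2 ≤ ∑ _i : Fin 3, ‖v‖ ^ 2 := Finset.sum_le_sum fun i _ => hv i
    _ ≤ (2 * ‖v‖) ^ 2 := by
      simp; nlinarith [sq_nonneg ‖v‖]

theorem steklov_hasDerivAt {f : ℝ → V3} (hf : Continuous f) (δ t : ℝ) :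
    HasDerivAt (steklov δ f) (δ⁻¹ • (f (t + δ) - f t)) t := by
  have hprim : ∀ s, HasDerivAt (fun x => ∫ r in (0 : ℝ)..x, f r) (f s) s := fun s =>
    intervalIntegral.integral_hasDerivAt_right (hf.intervalIntegrable _ _)
      hf.stronglyMeasurable.stronglyMeasurableAtFilter hf.continuousAt
  have heq : steklov δ f = fun t => δ⁻¹ •
      ((∫ r in (0 : ℝ)..t + δ, f r) - ∫ r in (0 : ℝ)..t, f r) := by
    funext s
    rw [steklov, intervalIntegral.integral_interval_sub_left
      (hf.intervalIntegrable _ _) (hf.intervalIntegrable _ _)]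
  rw [heq]
  exact (((hprim (t + δ)).comp_add_const t δ).sub (hprim t)).const_smul δ⁻¹

theorem steklov_deriv {f : ℝ → V3} (hf : Continuous f) (δ : ℝ) :
    deriv (steklov δ f) = fun t => δ⁻¹ • (f (t + δ) - f t) :=
  funext fun t => (steklov_hasDerivAt hf δ t).deriv

theorem steklov_contDiff {f : ℝ → V3} (n : ℕ) (hf : ContDiff ℝ n f) (δ : ℝ) :
    ContDiff ℝ (n + 1) (steklov δ f) := by
  have hd := steklov_hasDerivAt hf.continuous δ
  rw [contDiff_succ_iff_deriv]
  refine ⟨fun t => (hd t).differentiableAt, by simp, ?_⟩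
  rw [steklov_deriv hf.continuous]
  exact ((hf.comp (contDiff_id.add contDiff_const)).sub hf).const_smul δ⁻¹

theorem norm_steklov_deriv_le {f : ℝ → V3} {K : ℝ≥0} (hf : LipschitzWith K f) {δ : ℝ}
    (hδ : 0 < δ) (t : ℝ) : ‖deriv (steklov δ f) t‖ ≤ K := by
  rw [steklov_deriv hf.continuous, norm_smul, norm_inv, Real.norm_of_nonneg hδ.le]
  have := hf.dist_le_mul (t + δ) t
  rw [dist_eq_norm, Real.dist_eq, add_sub_cancel_left, abs_of_pos hδ] at this
  rw [inv_mul_le_iff₀ hδ]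
  linarith

theorem steklov_lipschitz {f : ℝ → V3} {K : ℝ≥0} (hf : LipschitzWith K f) {δ : ℝ}
    (hδ : 0 < δ) : LipschitzWith K (steklov δ f) :=
  lipschitzWith_of_nnnorm_deriv_le
    (fun t => (steklov_hasDerivAt hf.continuous δ t).differentiableAt)
    fun t => norm_steklov_deriv_le hf hδ t

theorem norm_steklov_sub_le {f : ℝ → V3} {K : ℝ≥0} (hf : LipschitzWith K f) {δ : ℝ}
    (hδ : 0 < δ) (t : ℝ) : ‖steklov δ f t - f t‖ ≤ K * δ := by
  have heq : steklov δ f t - f t = δ⁻¹ • ∫ s in t..t + δ, (f s - f t) := by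
    rw [intervalIntegral.integral_sub (hf.continuous.intervalIntegrable _ _) (by simp),
      intervalIntegral.integral_const, smul_sub, steklov, add_sub_cancel_left, smul_smul,
      inv_mul_cancel₀ hδ.ne', one_smul]
  have hb : ‖∫ s in t..t + δ, (f s - f t)‖ ≤ K * δ * |t + δ - t| := by
    refine intervalIntegral.norm_integral_le_of_norm_le_const fun s hs => ?_
    rw [uIoc_of_le (by linarith)] at hs
    rw [← dist_eq_norm]
    refine (hf.dist_le_mul s t).trans ?_
    gcongr
    rw [Real.dist_eq, abs_of_nonneg (by linarith [hs.1])]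
    linarith [hs.2]
  rw [heq, norm_smul, norm_inv, Real.norm_of_nonneg hδ.le, inv_mul_le_iff₀ hδ]
  rw [add_sub_cancel_left, abs_of_pos hδ] at hb
  linarith

theorem IsTransition.steklov {f : ℝ → V3} {e : V3} {ℓ δ : ℝ} (hf : IsTransition f e ℓ)
    (hδ : 0 < δ) (hδ1 : δ ≤ 1) : IsTransition (steklov δ f) e (ℓ + 1) := by
  have key : ∀ t v, (∀ s ∈ Icc t (t + δ), f s = v) → _root_.steklov δ f t = v := by
    intro t v hv
    have : (∫ s in t..t + δ, f s) = ∫ _s in t..t + δ, v :=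
      intervalIntegral.integral_congr fun s hs => hv s (by rwa [uIcc_of_le (by linarith)] at hs)
    rw [_root_.steklov, this, intervalIntegral.integral_const, add_sub_cancel_left, smul_smul,
      inv_mul_cancel₀ hδ.ne', one_smul]
  exact ⟨fun t ht => key t _ fun s hs => hf.right s (by linarith [hs.1]),
    fun t ht => key t _ fun s hs => hf.left s (by linarith [hs.2])⟩

theorem IsTransition.mono {f : ℝ → V3} {e : V3} {ℓ ℓ' : ℝ} (hf : IsTransition f e ℓ)
    (hℓ : ℓ ≤ ℓ') : IsTransition f e ℓ' :=
  ⟨fun t ht => hf.right t (hℓ.trans ht), fun t ht => hf.left t (by linarith)⟩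

theorem IsTransition.eventuallyEq {f : ℝ → V3} {e : V3} {ℓ t : ℝ} (hf : IsTransition f e ℓ)
    (ht : ℓ < |t|) : ∃ c, f =ᶠ[𝓝 t] fun _ => c := by
  rcases lt_abs.1 ht with h | h
  · exact ⟨e, by filter_upwards [Ioi_mem_nhds h] with s hs using hf.right s (le_of_lt hs)⟩
  · have h' : t < -ℓ := by linarith
    exact ⟨-e, by filter_upwards [Iio_mem_nhds h'] with s hs using hf.left s (le_of_lt hs)⟩

theorem IsTransition.deriv_eq_zero {f : ℝ → V3} {e : V3} {ℓ t : ℝ} (hf : IsTransition f e ℓ)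
    (ht : ℓ < |t|) : deriv f t = 0 := by
  obtain ⟨c, hc⟩ := hf.eventuallyEq ht
  rw [hc.deriv_eq, deriv_const]

theorem IsTransition.deriv_deriv_eq_zero {f : ℝ → V3} {e : V3} {ℓ t : ℝ}
    (hf : IsTransition f e ℓ) (ht : ℓ < |t|) : deriv (deriv f) t = 0 := by
  obtain ⟨c, hc⟩ := hf.eventuallyEq ht
  rw [hc.deriv.deriv_eq]
  simp

theorem exists_bound_of_eq_zero {E : Type*} [NormedAddCommGroup E] {f : ℝ → E}
    (hf : Continuous f) {ℓ : ℝ} (h0 : ∀ t, ℓ < |t| → f t = 0) :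
    ∃ M, 0 ≤ M ∧ ∀ t, ‖f t‖ ≤ M := by
  obtain ⟨M, hM⟩ := (isCompact_Icc (a := -ℓ) (b := ℓ)).exists_bound_of_continuousOn
    hf.continuousOn
  refine ⟨max M 0, le_max_right _ _, fun t => ?_⟩
  by_cases ht : |t| ≤ ℓ
  · exact (hM t (abs_le.1 ht)).trans (le_max_left _ _)
  · rw [h0 t (not_le.1 ht), norm_zero]
    exact le_max_right _ _

theorem IsTransition.exists_bound {f : ℝ → V3} {e : V3} {ℓ : ℝ} (hf : IsTransition f e ℓ)
    (hc : Continuous f) : ∃ M, 0 ≤ M ∧ ∀ t, ‖f t‖ ≤ M := by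
  obtain ⟨M, hM⟩ := (isCompact_Icc (a := -ℓ) (b := ℓ)).exists_bound_of_continuousOn
    hc.continuousOn
  refine ⟨max M ‖e‖, (norm_nonneg e).trans (le_max_right _ _), fun t => ?_⟩
  by_cases ht : |t| ≤ ℓ
  · exact (hM t (abs_le.1 ht)).trans (le_max_left _ _)
  · rcases lt_abs.1 (not_le.1 ht) with h | h
    · rw [hf.right t h.le]; exact le_max_right _ _
    · rw [hf.left t (by linarith), norm_neg]; exact le_max_right _ _

theorem exists_bound_on_ball {W : M33 → ℝ} (hW : Continuous W) (M : ℝ) :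
    ∃ C, 0 ≤ C ∧ ∀ v₁ v₂ : V3, ‖v₁‖ ≤ M → ‖v₂‖ ≤ M → |W ![v₁, 0, v₂]| ≤ C := by
  have hc : Continuous fun v : V3 × V3 => W ![v.1, 0, v.2] := by
    refine hW.comp (continuous_pi fun i => ?_)
    fin_cases i <;> simp <;> fun_prop
  obtain ⟨C, hC⟩ := (isCompact_closedBall (0 : V3 × V3) M).exists_bound_of_continuousOn
    hc.continuousOn
  refine ⟨max C 0, le_max_right _ _, fun v₁ v₂ h₁ h₂ => (hC (v₁, v₂) ?_).trans (le_max_left _ _)⟩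
  simp [Prod.norm_def, h₁, h₂]

/-- The potential vanishes at both wells once they are written in terms of `a` and `A₃`. -/
structure VanishesAtWells (W : M33 → ℝ) (a b : V3) : Prop where
  pos : W ![a, 0, b] = 0
  neg : W ![-a, 0, -b] = 0

theorem VanishesAtWells.eq_zero {W : M33 → ℝ} {a b : V3} (hw : VanishesAtWells W a b)
    {φ₁ φ₂ : ℝ → V3} {ℓ t : ℝ} (h₁ : IsTransition φ₁ a ℓ) (h₂ : IsTransition φ₂ b ℓ)
    (ht : ℓ < |t|) : W ![φ₁ t, 0, φ₂ t] = 0 := by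
  rcases lt_abs.1 ht with h | h
  · rw [h₁.right t h.le, h₂.right t h.le, hw.pos]
  · rw [h₁.left t (by linarith), h₂.left t (by linarith), hw.neg]

theorem measurable_profile_integrand {W : M33 → ℝ} (hW : Continuous W) {φ₁ φ₂ : ℝ → V3}
    (h₁ : Continuous φ₁) (h₂ : Continuous φ₂) :
    Measurable fun t => ENNReal.ofReal (W ![φ₁ t, 0, φ₂ t]
      + vnorm (deriv φ₁ t) ^ 2 + 2 * vnorm (deriv φ₂ t) ^ 2) := by
  have hc : Continuous fun t => W ![φ₁ t, 0, φ₂ t] := by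
    refine hW.comp (continuous_pi fun i => ?_)
    fin_cases i <;> simp <;> fun_prop
  have hm : ∀ f : ℝ → V3, Measurable fun t => vnorm (deriv f t) := fun f =>
    continuous_vnorm.measurable.comp (measurable_deriv f)
  exact ((hc.measurable.add ((hm φ₁).pow_const 2)).add
    (((hm φ₂).pow_const 2).const_mul 2)).ennreal_ofReal

theorem tendsto_profileEnergy_steklov {W : M33 → ℝ} (hW : Continuous W) {a b : V3}
    (hw : VanishesAtWells W a b) {φ₁ φ₂ : ℝ → V3} {ℓ : ℝ} {K₁ K₂ : ℝ≥0}
    (h₁ : IsTransition φ₁ a ℓ) (h₂ : IsTransition φ₂ b ℓ)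
    (hK₁ : LipschitzWith K₁ φ₁) (hK₂ : LipschitzWith K₂ φ₂) :
    Tendsto (fun δ => profileEnergy W (steklov δ φ₁) (steklov δ φ₂)) (𝓝[>] 0)
      (𝓝 (profileEnergy W φ₁ φ₂)) := by
  obtain ⟨M₁, hM₁0, hM₁⟩ := h₁.exists_bound hK₁.continuous
  obtain ⟨M₂, hM₂0, hM₂⟩ := h₂.exists_bound hK₂.continuous
  obtain ⟨C, hC0, hC⟩ := exists_bound_on_ball hW (max (M₁ + K₁) (M₂ + K₂))
  have hsmall : ∀ᶠ δ : ℝ in 𝓝[>] 0, 0 < δ ∧ δ ≤ 1 := by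
    filter_upwards [Ioc_mem_nhdsGT (zero_lt_one' ℝ)] with δ hδ using hδ
  have hsub : ∀ {f : ℝ → V3} {K : ℝ≥0} {M : ℝ}, LipschitzWith K f → (∀ t, ‖f t‖ ≤ M) →
      ∀ {δ : ℝ}, 0 < δ → δ ≤ 1 → ∀ t, ‖steklov δ f t‖ ≤ M + K := by
    intro f K M hf hM δ hδ hδ1 t
    have := norm_steklov_sub_le hf hδ t
    have hKδ : (K : ℝ) * δ ≤ K := mul_le_of_le_one_right K.2 hδ1
    calc ‖steklov δ f t‖ = ‖f t + (steklov δ f t - f t)‖ := by rw [add_sub_cancel]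
      _ ≤ ‖f t‖ + ‖steklov δ f t - f t‖ := norm_add_le _ _
      _ ≤ M + K := by linarith [hM t]
  have hlim : ∀ {f : ℝ → V3} {K : ℝ≥0}, LipschitzWith K f → ∀ t,
      Tendsto (fun δ => steklov δ f t) (𝓝[>] 0) (𝓝 (f t)) := by
    intro f K hf t
    rw [tendsto_iff_norm_sub_tendsto_zero]
    have hz : Tendsto (fun δ : ℝ => (K : ℝ) * δ) (𝓝[>] 0) (𝓝 0) := by
      have : Tendsto (fun δ : ℝ => (K : ℝ) * δ) (𝓝 0) (𝓝 (K * 0)) :=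
        (continuous_const.mul continuous_id).tendsto 0
      rw [mul_zero] at this
      exact this.mono_left nhdsWithin_le_nhds
    refine squeeze_zero' (Eventually.of_forall fun _ => norm_nonneg _) ?_ hz
    filter_upwards [self_mem_nhdsWithin] with δ hδ using norm_steklov_sub_le hf hδ t
  have hdlim : ∀ {f : ℝ → V3} {K : ℝ≥0}, LipschitzWith K f → ∀ t, DifferentiableAt ℝ f t →
      Tendsto (fun δ => deriv (steklov δ f) t) (𝓝[>] 0) (𝓝 (deriv f t)) := by
    intro f K hf t ht
    have := ht.hasDerivAt.tendsto_slope_zero_right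
    simpa only [steklov_deriv hf.continuous] using this
  unfold profileEnergy
  refine tendsto_lintegral_filter_of_dominated_convergence
    ((Icc (-(ℓ + 1)) (ℓ + 1)).indicator fun _ =>
      ENNReal.ofReal (C + (2 * K₁) ^ 2 + 2 * (2 * K₂) ^ 2)) ?_ ?_ ?_ ?_
  · filter_upwards [hsmall] with δ hδ
    exact measurable_profile_integrand hW (steklov_lipschitz hK₁ hδ.1).continuous
      (steklov_lipschitz hK₂ hδ.1).continuous
  · filter_upwards [hsmall] with δ hδ
    refine Eventually.of_forall fun t => ?_
    by_cases ht : t ∈ Icc (-(ℓ + 1)) (ℓ + 1)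
    · rw [indicator_of_mem ht]
      refine ENNReal.ofReal_le_ofReal ?_
      have e₁ : vnorm (deriv (steklov δ φ₁) t) ≤ 2 * K₁ :=
        (vnorm_le _).trans (by linarith [norm_steklov_deriv_le hK₁ hδ.1 t])
      have e₂ : vnorm (deriv (steklov δ φ₂) t) ≤ 2 * K₂ :=
        (vnorm_le _).trans (by linarith [norm_steklov_deriv_le hK₂ hδ.1 t])
      have e₀ := (le_abs_self _).trans (hC _ _
        ((hsub hK₁ hM₁ hδ.1 hδ.2 t).trans (le_max_left _ _))
        ((hsub hK₂ hM₂ hδ.1 hδ.2 t).trans (le_max_right _ _)))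
      have f₁ := pow_le_pow_left₀ (vnorm_nonneg _) e₁ 2
      have f₂ := pow_le_pow_left₀ (vnorm_nonneg _) e₂ 2
      linarith
    · have ht' : ℓ + 1 < |t| := by
        rw [← not_le, abs_le]; exact ht
      have s₁ := h₁.steklov hδ.1 hδ.2
      have s₂ := h₂.steklov hδ.1 hδ.2
      rw [indicator_of_notMem ht, hw.eq_zero s₁ s₂ ht', s₁.deriv_eq_zero ht',
        s₂.deriv_eq_zero ht']
      simp [vnorm_zero]
  · rw [lintegral_indicator measurableSet_Icc, setLIntegral_const]
    exact ENNReal.mul_ne_top ENNReal.ofReal_ne_top (by simp)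
  · filter_upwards [hK₁.ae_differentiableAt, hK₂.ae_differentiableAt] with t ht₁ ht₂
    refine (ENNReal.continuous_ofReal.tendsto _).comp ?_
    have hWt : Tendsto (fun δ => W ![steklov δ φ₁ t, 0, steklov δ φ₂ t]) (𝓝[>] 0)
        (𝓝 (W ![φ₁ t, 0, φ₂ t])) := by
      refine (hW.tendsto _).comp (tendsto_pi_nhds.2 fun i => ?_)
      fin_cases i
      · exact hlim hK₁ t
      · exact tendsto_const_nhds
      · exact hlim hK₂ t
    have hv₁ := (continuous_vnorm.tendsto _).comp (hdlim hK₁ t ht₁)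
    have hv₂ := (continuous_vnorm.tendsto _).comp (hdlim hK₂ t ht₂)
    exact (hWt.add (hv₁.pow 2)).add ((hv₂.pow 2).const_mul 2)

/-- Energies of the transition profiles that are `Cⁿ` and Lipschitz. -/
def smoothEnergies (W : M33 → ℝ) (a b : V3) (n : ℕ) : Set ℝ≥0∞ :=
  {E | ∃ (φ₁ φ₂ : ℝ → V3) (ℓ : ℝ) (K₁ K₂ : ℝ≥0), ContDiff ℝ n φ₁ ∧ ContDiff ℝ n φ₂ ∧
    LipschitzWith K₁ φ₁ ∧ LipschitzWith K₂ φ₂ ∧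
    IsTransition φ₁ a ℓ ∧ IsTransition φ₂ b ℓ ∧ E = profileEnergy W φ₁ φ₂}

theorem smoothEnergies_subset_closure {W : M33 → ℝ} (hW : Continuous W) {a b : V3}
    (hw : VanishesAtWells W a b) (n : ℕ) :
    smoothEnergies W a b n ⊆ closure (smoothEnergies W a b (n + 1)) := by
  rintro _ ⟨φ₁, φ₂, ℓ, K₁, K₂, c₁, c₂, k₁, k₂, t₁, t₂, rfl⟩
  refine mem_closure_of_tendsto (tendsto_profileEnergy_steklov hW hw t₁ t₂ k₁ k₂) ?_
  filter_upwards [Ioc_mem_nhdsGT (zero_lt_one' ℝ)] with δ hδ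
  exact ⟨_, _, ℓ + 1, K₁, K₂, mod_cast steklov_contDiff n c₁ δ,
    mod_cast steklov_contDiff n c₂ δ,
    steklov_lipschitz k₁ hδ.1, steklov_lipschitz k₂ hδ.1, t₁.steklov hδ.1 hδ.2,
    t₂.steklov hδ.1 hδ.2, rfl⟩

theorem contDiffOn_Icc_exists_lipschitz {f : ℝ → V3} {c d : ℝ} (hcd : c ≤ d)
    (hf : ContDiffOn ℝ 1 f (Icc c d)) :
    ∃ K : ℝ≥0, LipschitzOnWith K f (Icc c d) := by
  rcases hcd.eq_or_lt with rfl | hlt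
  · exact ⟨0, by simp⟩
  have hu := uniqueDiffOn_Icc hlt
  obtain ⟨M, hM⟩ := isCompact_Icc.exists_bound_of_continuousOn
    (hf.continuousOn_derivWithin hu le_rfl)
  refine ⟨M.toNNReal, (convex_Icc c d).lipschitzOnWith_of_nnnorm_derivWithin_le
    (hf.differentiableOn one_ne_zero) fun x hx => ?_⟩
  rw [← NNReal.coe_le_coe, coe_nnnorm]
  exact (hM x hx).trans (Real.le_coe_toNNReal M)

theorem K0_mem_closure_smoothEnergies {W : M33 → ℝ} (hW : Continuous W) {a b : V3}
    (hw : VanishesAtWells W a b) :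
    K0 W a b ∈ closure (smoothEnergies W a b 2) := by
  have hstep : smoothEnergies W a b 0 ⊆ closure (smoothEnergies W a b 2) :=
    (smoothEnergies_subset_closure hW hw 0).trans
      (closure_minimal (smoothEnergies_subset_closure hW hw 1) isClosed_closure)
  refine closure_minimal hstep isClosed_closure ?_
  unfold K0
  refine closure_mono ?_ (sInf_mem_closure ?_)
  · rintro _ ⟨ℓ, hℓ, φ₁, φ₂, c₁, c₂, r₁, r₂, l₁, l₂, rfl⟩
    have hle : -ℓ ≤ ℓ := by linarith
    have hext : ∀ (φ : ℝ → V3) (e : V3), ContDiffOn ℝ 1 φ (Icc (-ℓ) ℓ) → φ ℓ = e → φ (-ℓ) = -e →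
        IsTransition (IccExtend hle fun t => φ t) e ℓ ∧
          ∃ K, LipschitzWith K (IccExtend hle fun t => φ t) := by
      intro φ e hc hr hl
      refine ⟨⟨fun t ht => ?_, fun t ht => ?_⟩, ?_⟩
      · rw [IccExtend_of_right_le hle _ ht]; exact hr
      · rw [IccExtend_of_le_left hle _ ht]; exact hl
      · obtain ⟨K, hK⟩ := contDiffOn_Icc_exists_lipschitz hle hc
        exact ⟨K * 1, hK.to_restrict.comp (LipschitzWith.projIcc hle)⟩
    obtain ⟨t₁, K₁, k₁⟩ := hext φ₁ a c₁ r₁ l₁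
    obtain ⟨t₂, K₂, k₂⟩ := hext φ₂ b c₂ r₂ l₂
    refine ⟨_, _, ℓ, K₁, K₂, by simpa using k₁.continuous, by simpa using k₂.continuous,
      k₁, k₂, t₁, t₂, ?_⟩
    unfold profileEnergy
    rw [← lintegral_indicator measurableSet_Ioo]
    have hae : ∀ᵐ t : ℝ, t ≠ -ℓ ∧ t ≠ ℓ := by
      have h := (measure_singleton (μ := (volume : Measure ℝ)) (-ℓ))
      have h' := (measure_singleton (μ := (volume : Measure ℝ)) ℓ)
      filter_upwards [compl_mem_ae_iff.2 h, compl_mem_ae_iff.2 h'] with t ht ht' using ⟨ht, ht'⟩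
    refine lintegral_congr_ae ?_
    filter_upwards [hae] with t ht
    by_cases hm : t ∈ Ioo (-ℓ) ℓ
    · have hd : ∀ φ : ℝ → V3, deriv (IccExtend hle fun t => φ t) t
          = derivWithin φ (Icc (-ℓ) ℓ) t := by
        intro φ
        rw [derivWithin_of_mem_nhds (Icc_mem_nhds hm.1 hm.2)]
        refine EventuallyEq.deriv_eq ?_
        filter_upwards [Icc_mem_nhds hm.1 hm.2] with s hs
        rw [IccExtend_of_mem hle _ hs]
      rw [indicator_of_mem hm, hd, hd, IccExtend_of_mem hle _ (Ioo_subset_Icc_self hm),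
        IccExtend_of_mem hle _ (Ioo_subset_Icc_self hm)]
    · have ht' : ℓ < |t| := by
        rw [lt_abs]
        by_contra hcon
        push Not at hcon
        exact hm ⟨lt_of_le_of_ne (by linarith [hcon.2]) (Ne.symm ht.1),
          lt_of_le_of_ne hcon.1 ht.2⟩
      rw [indicator_of_notMem hm, hw.eq_zero t₁ t₂ ht', t₁.deriv_eq_zero ht',
        t₂.deriv_eq_zero ht']
      simp [vnorm_zero]
  · refine ⟨_, 1, one_pos, fun t => t • a, fun t => t • b, ?_, ?_, by simp, by simp, by simp,
      by simp, rfl⟩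
    · exact (contDiff_id.smul contDiff_const).contDiffOn
    · exact (contDiff_id.smul contDiff_const).contDiffOn

/-- The orientation of the `i`-th interface: `1` if the phase changes from `-` to `+`. -/
def interfaceSign (σ : ℝ) (i : ℕ) : ℝ := -(σ * (-1) ^ i)

theorem interfaceSign_eq {σ : ℝ} (hσ : σ = 1 ∨ σ = -1) (i : ℕ) :
    interfaceSign σ i = 1 ∨ interfaceSign σ i = -1 := by
  unfold interfaceSign
  rcases hσ with rfl | rfl <;> rcases neg_one_pow_eq_or ℝ i with h | h <;> simp [h]

theorem abs_interfaceSign {σ : ℝ} (hσ : σ = 1 ∨ σ = -1) (i : ℕ) :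
    |interfaceSign σ i| = 1 := by
  rcases interfaceSign_eq hσ i with h | h <;> simp [h]

/-- The rescaled coordinate `sᵢ (t - αᵢ) / ε` across the `i`-th interface. -/
noncomputable def layerCoord (σ : ℝ) {m : ℕ} (α : Fin m → ℝ) (ε : ℝ) (i : Fin m) (t : ℝ) : ℝ :=
  interfaceSign σ i / ε * (t - α i)

/-- Superposition of rescaled copies of `Ψ` at the interfaces, with weights `(sᵢ / ε)ᵏ`. -/
noncomputable def layerSum (σ : ℝ) {m : ℕ} (α : Fin m → ℝ) (ε : ℝ) (k : ℕ) (Ψ : ℝ → V3)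
    (t : ℝ) : V3 :=
  ∑ i : Fin m, (interfaceSign σ i / ε) ^ k • Ψ (layerCoord σ α ε i t)

/-- The profile which runs through a rescaled copy of `Φ` at every interface. -/
noncomputable def ladder (σ : ℝ) {m : ℕ} (α : Fin m → ℝ) (ε : ℝ) (Φ : ℝ → V3) (e : V3)
    (t : ℝ) : V3 :=
  (σ • e + ∑ i : Fin m, interfaceSign σ i • e) + layerSum σ α ε 0 Φ t

section Layers

variable {σ : ℝ} {m : ℕ} {α : Fin m → ℝ} {ε ℓ : ℝ}

theorem layerSum_hasDerivAt {Ψ Ψ' : ℝ → V3} (hΨ : ∀ t, HasDerivAt Ψ (Ψ' t) t) (k : ℕ) (t : ℝ) :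
    HasDerivAt (layerSum σ α ε k Ψ) (layerSum σ α ε (k + 1) Ψ' t) t := by
  unfold layerSum
  refine HasDerivAt.fun_sum fun i _ => ?_
  have hc : HasDerivAt (layerCoord σ α ε i) (interfaceSign σ i / ε) t := by
    have := ((hasDerivAt_id t).sub_const (α i)).const_mul (interfaceSign σ i / ε)
    exact mul_one (interfaceSign σ i / ε) ▸ this
  have := ((hΨ _).scomp t hc).const_smul ((interfaceSign σ i / ε) ^ k)
  rw [pow_succ, mul_smul]
  exact this

theorem ladder_hasDerivAt {Φ Φ' : ℝ → V3} (hΦ : ∀ t, HasDerivAt Φ (Φ' t) t) (e : V3) (t : ℝ) :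
    HasDerivAt (ladder σ α ε Φ e) (layerSum σ α ε 1 Φ' t) t :=
  (layerSum_hasDerivAt hΦ 0 t).const_add _

theorem layerSum_continuous {Ψ : ℝ → V3} (hΨ : Continuous Ψ) (k : ℕ) :
    Continuous (layerSum σ α ε k Ψ) := by
  unfold layerSum layerCoord
  fun_prop

theorem norm_layerSum_le {Ψ : ℝ → V3} {M : ℝ} (hσ : σ = 1 ∨ σ = -1) (hε : 0 < ε)
    (hM : ∀ t, ‖Ψ t‖ ≤ M) (k : ℕ) (t : ℝ) :
    ‖layerSum σ α ε k Ψ t‖ ≤ m * ((ε⁻¹) ^ k * M) := by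
  refine (norm_sum_le _ _).trans ?_
  calc _ ≤ ∑ _i : Fin m, (ε⁻¹) ^ k * M := by
        refine Finset.sum_le_sum fun i _ => ?_
        rw [norm_smul, norm_pow, norm_div, Real.norm_eq_abs, abs_interfaceSign hσ,
          Real.norm_of_nonneg hε.le, one_div]
        gcongr
        exact hM _
    _ = m * ((ε⁻¹) ^ k * M) := by simp

theorem norm_ladder_le {Φ : ℝ → V3} {e : V3} {M : ℝ} (hσ : σ = 1 ∨ σ = -1) (hε : 0 < ε)
    (hM : ∀ t, ‖Φ t‖ ≤ M) (t : ℝ) :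
    ‖ladder σ α ε Φ e t‖ ≤ ‖σ • e + ∑ i : Fin m, interfaceSign σ i • e‖ + m * M := by
  refine (norm_add_le _ _).trans ?_
  gcongr
  simpa using norm_layerSum_le (α := α) hσ hε hM 0 t

theorem abs_layerCoord (hσ : σ = 1 ∨ σ = -1) (hε : 0 < ε) (i : Fin m) (t : ℝ) :
    |layerCoord σ α ε i t| = |t - α i| / ε := by
  rw [layerCoord, abs_mul, abs_div, abs_interfaceSign hσ, abs_of_pos hε]
  ring

theorem lt_abs_layerCoord (hσ : σ = 1 ∨ σ = -1) (hε : 0 < ε) {i : Fin m} {t : ℝ}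
    (ht : ε * ℓ < |t - α i|) : ℓ < |layerCoord σ α ε i t| := by
  rw [abs_layerCoord hσ hε, lt_div_iff₀ hε]
  linarith

theorem layerSum_eq_zero (hσ : σ = 1 ∨ σ = -1) (hε : 0 < ε) {Ψ : ℝ → V3}
    (hΨ : ∀ τ, ℓ < |τ| → Ψ τ = 0) {t : ℝ} (ht : ∀ i, ε * ℓ < |t - α i|) (k : ℕ) :
    layerSum σ α ε k Ψ t = 0 :=
  Finset.sum_eq_zero fun i _ => by rw [hΨ _ (lt_abs_layerCoord hσ hε (ht i)), smul_zero]

theorem layerSum_eq_single (hσ : σ = 1 ∨ σ = -1) (hε : 0 < ε) {Ψ : ℝ → V3}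
    (hΨ : ∀ τ, ℓ < |τ| → Ψ τ = 0) {t : ℝ} {j : Fin m}
    (ht : ∀ i, i ≠ j → ε * ℓ < |t - α i|) (k : ℕ) :
    layerSum σ α ε k Ψ t = (interfaceSign σ j / ε) ^ k • Ψ (layerCoord σ α ε j t) :=
  Finset.sum_eq_single_of_mem j (Finset.mem_univ _) fun i _ hij => by
    rw [hΨ _ (lt_abs_layerCoord hσ hε (ht i hij)), smul_zero]

theorem sum_interfaceSign (σ : ℝ) {k : ℕ} (hk : k ≤ m) :
    ∑ i : Fin m, (if (i : ℕ) < k then 2 * interfaceSign σ i else 0) = σ * (-1) ^ k - σ := by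
  rw [Fin.sum_univ_eq_sum_range (fun i => if i < k then 2 * interfaceSign σ i else 0) m,
    ← Finset.sum_filter]
  have : (Finset.range m).filter (· < k) = Finset.range k := by
    ext i; simp; omega
  rw [this]
  clear this hk
  induction k with
  | zero => simp
  | succ k ih => rw [Finset.sum_range_succ, ih, interfaceSign]; ring

theorem lt_iff_lt_cnt (hα : StrictMono α) (t : ℝ) (i : Fin m) :
    α i < t ↔ (i : ℕ) < cnt m α t := by
  unfold cnt
  constructor
  · intro hi
    have : Finset.Iic i ⊆ Finset.univ.filter fun j => α j < t := fun j hj => by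
      simp only [Finset.mem_filter, Finset.mem_univ, true_and]
      exact (hα.monotone (Finset.mem_Iic.1 hj)).trans_lt hi
    have := Finset.card_le_card this
    rw [Fin.card_Iic] at this
    omega
  · intro hi
    by_contra hcon
    have : (Finset.univ.filter fun j => α j < t) ⊆ Finset.Iio i := fun j hj => by
      simp only [Finset.mem_filter, Finset.mem_univ, true_and] at hj
      exact Finset.mem_Iio.2 (hα.lt_iff_lt.1 (hj.trans_le (not_lt.1 hcon)))
    have := Finset.card_le_card this
    rw [Fin.card_Iio] at this
    omega

theorem cnt_le (t : ℝ) : cnt m α t ≤ m := by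
  unfold cnt
  exact (Finset.card_filter_le _ _).trans (by simp)

theorem IsTransition.layer_term {Φ : ℝ → V3} {e : V3} (hΦ : IsTransition Φ e ℓ)
    (hσ : σ = 1 ∨ σ = -1) (hε : 0 < ε) (hℓ : 0 ≤ ℓ) {i : Fin m} {t : ℝ}
    (ht : ε * ℓ < |t - α i|) :
    interfaceSign σ i • e + Φ (layerCoord σ α ε i t)
      = (if α i < t then 2 * interfaceSign σ i else 0) • e := by
  have hpos : 0 ≤ ε * ℓ := by positivity
  have hΦr : ∀ x, ε * ℓ < x → Φ (ε⁻¹ * x) = e := fun x hx => hΦ.right _ <| by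
    rw [← div_eq_inv_mul, le_div_iff₀ hε]; linarith
  have hΦl : ∀ x, ε * ℓ < -x → Φ (ε⁻¹ * x) = -e := fun x hx => hΦ.left _ <| by
    rw [← div_eq_inv_mul, div_le_iff₀ hε]; linarith
  by_cases hlt : α i < t
  · rw [abs_of_pos (sub_pos.2 hlt)] at ht
    rw [if_pos hlt, layerCoord]
    rcases interfaceSign_eq hσ (i : ℕ) with hs | hs <;> rw [hs]
    · rw [one_div, hΦr _ ht, mul_one, one_smul, two_smul]
    · rw [neg_div, one_div, neg_mul, ← mul_neg, hΦl _ (by linarith)]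
      module
  · rw [abs_of_nonpos (by linarith)] at ht
    rw [if_neg hlt, layerCoord, zero_smul]
    rcases interfaceSign_eq hσ (i : ℕ) with hs | hs <;> rw [hs]
    · rw [one_div, hΦl _ ht]
      module
    · rw [neg_div, one_div, neg_mul, ← mul_neg, hΦr _ (by linarith)]
      module

theorem ladder_eq_sum (Φ : ℝ → V3) (e : V3) (t : ℝ) :
    ladder σ α ε Φ e t
      = σ • e + ∑ i : Fin m, (interfaceSign σ i • e + Φ (layerCoord σ α ε i t)) := by
  simp only [ladder, layerSum, pow_zero, one_smul, Finset.sum_add_distrib, add_assoc]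

theorem ladder_eq_phase {Φ : ℝ → V3} {e : V3} (hΦ : IsTransition Φ e ℓ)
    (hσ : σ = 1 ∨ σ = -1) (hα : StrictMono α) (hε : 0 < ε) (hℓ : 0 ≤ ℓ) {t : ℝ}
    (ht : ∀ i, ε * ℓ < |t - α i|) :
    ladder σ α ε Φ e t = (σ * (-1) ^ cnt m α t) • e := by
  rw [ladder_eq_sum, Finset.sum_congr rfl fun i _ => hΦ.layer_term hσ hε hℓ (ht i),
    ← Finset.sum_smul]
  simp only [lt_iff_lt_cnt hα]
  rw [sum_interfaceSign σ (cnt_le t)]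
  module

theorem ladder_eq_layer {Φ : ℝ → V3} {e : V3} (hΦ : IsTransition Φ e ℓ)
    (hσ : σ = 1 ∨ σ = -1) (hα : StrictMono α) (hε : 0 < ε) (hℓ : 0 ≤ ℓ) {t : ℝ} {j : Fin m}
    (hj : |t - α j| ≤ ε * ℓ) (ht : ∀ i, i ≠ j → ε * ℓ < |t - α i|) :
    ladder σ α ε Φ e t = Φ (layerCoord σ α ε j t) := by
  have hiff : ∀ i, i ≠ j → (α i < t ↔ (i : ℕ) < j) := by
    intro i hij
    have hd := hj.trans_lt (ht i hij)
    rw [Fin.val_fin_lt, ← hα.lt_iff_lt]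
    constructor
    · intro hi
      by_contra hcon
      rw [abs_of_pos (sub_pos.2 hi), abs_of_pos (by linarith)] at hd
      linarith
    · intro hi
      by_contra hcon
      rw [abs_of_nonpos (by linarith), abs_of_nonpos (by linarith)] at hd
      linarith
  have hsum : ∑ i ∈ Finset.univ.erase j, (interfaceSign σ i • e + Φ (layerCoord σ α ε i t))
      = (σ * (-1) ^ (j : ℕ) - σ) • e := by
    rw [← sum_interfaceSign σ j.2.le, Finset.sum_smul, ← Finset.add_sum_erase _ _
      (Finset.mem_univ j)]
    simp only [lt_irrefl, if_false, zero_smul, zero_add]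
    refine Finset.sum_congr rfl fun i hi => ?_
    have hij := Finset.ne_of_mem_erase hi
    rw [hΦ.layer_term hσ hε hℓ (ht i hij)]
    simp only [hiff i hij]
  rw [ladder_eq_sum, ← Finset.add_sum_erase _ _ (Finset.mem_univ j), hsum]
  unfold interfaceSign
  module

theorem eventually_separated (hα : StrictMono α) {ι : Type*} {l : Filter ι} {ε : ι → ℝ}
    (hε0 : Tendsto ε l (𝓝 0)) (ℓ : ℝ) :
    ∀ᶠ n in l, ∀ t j, |t - α j| ≤ ε n * ℓ → ∀ i, i ≠ j → ε n * ℓ < |t - α i| := by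
  have hlim : Tendsto (fun n => 2 * (ε n * ℓ)) l (𝓝 0) := by
    simpa using (hε0.mul_const ℓ).const_mul 2
  have : ∀ᶠ n in l, ∀ i j, i ≠ j → 2 * (ε n * ℓ) < |α i - α j| := by
    simp only [eventually_all]
    intro i j hij
    exact hlim.eventually_lt_const (abs_pos.2 (sub_ne_zero.2 (hα.injective.ne hij)))
  filter_upwards [this] with n hn t j hj i hij
  have := hn i j hij
  have htri : |α i - α j| ≤ |t - α i| + |t - α j| := by
    have := abs_sub_le (α i) t (α j)
    rwa [abs_sub_comm (α i) t] at this
  linarith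

theorem eventually_far {ι : Type*} {l : Filter ι} {ε : ι → ℝ}
    (hε0 : Tendsto ε l (𝓝 0)) (ℓ : ℝ) {t : ℝ} (ht : t ∉ range α) :
    ∀ᶠ n in l, ∀ i, ε n * ℓ < |t - α i| := by
  have hlim : Tendsto (fun n => ε n * ℓ) l (𝓝 0) := by simpa using hε0.mul_const ℓ
  rw [eventually_all]
  intro i
  exact hlim.eventually_lt_const (abs_pos.2 (sub_ne_zero.2 fun h => ht ⟨i, h.symm⟩))

end Layers

section SeparatedMap

variable {f f' k k' : ℝ → V3} {c c' : ℝ → ℝ}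

/-- The differential of `x ↦ f(x₁) + c(x₃) k(x₁)` written through its two columns. -/
noncomputable def columnsDiff (v w : V3) : Pt →L[ℝ] V3 :=
  (ContinuousLinearMap.fst ℝ ℝ (ℝ × ℝ)).smulRight v
    + ((ContinuousLinearMap.snd ℝ ℝ ℝ).comp (ContinuousLinearMap.snd ℝ ℝ (ℝ × ℝ))).smulRight w

theorem hasFDerivAt_separated (hf : ∀ t, HasDerivAt f (f' t) t)
    (hk : ∀ t, HasDerivAt k (k' t) t) (hc : ∀ t, HasDerivAt c (c' t) t) (x : Pt) :
    HasFDerivAt (fun x : Pt => f x.1 + c x.2.2 • k x.1)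
      (columnsDiff (f' x.1 + c x.2.2 • k' x.1) (c' x.2.2 • k x.1)) x := by
  have h1 : HasFDerivAt (fun x : Pt => x.1) (ContinuousLinearMap.fst ℝ ℝ (ℝ × ℝ)) x :=
    hasFDerivAt_fst
  have h3 : HasFDerivAt (fun x : Pt => x.2.2)
      ((ContinuousLinearMap.snd ℝ ℝ ℝ).comp (ContinuousLinearMap.snd ℝ ℝ (ℝ × ℝ))) x :=
    ((ContinuousLinearMap.snd ℝ ℝ ℝ).comp (ContinuousLinearMap.snd ℝ ℝ (ℝ × ℝ))).hasFDerivAt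
  have hF := (hf x.1).hasFDerivAt.comp x h1
  have hK := (hk x.1).hasFDerivAt.comp x h1
  have hC := (hc x.2.2).hasFDerivAt.comp x h3
  refine (hF.add (hC.smul hK)).congr_fderiv ?_
  ext y <;> simp [columnsDiff]

theorem pd_e1_separated (hf : ∀ t, HasDerivAt f (f' t) t) (hk : ∀ t, HasDerivAt k (k' t) t)
    (hc : ∀ t, HasDerivAt c (c' t) t) :
    pd e1 (fun x : Pt => f x.1 + c x.2.2 • k x.1)
      = fun x : Pt => f' x.1 + c x.2.2 • k' x.1 := by
  funext x
  rw [pd, (hasFDerivAt_separated hf hk hc x).fderiv]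
  simp [columnsDiff, e1]

theorem pd_e2_separated (hf : ∀ t, HasDerivAt f (f' t) t) (hk : ∀ t, HasDerivAt k (k' t) t)
    (hc : ∀ t, HasDerivAt c (c' t) t) :
    pd e2 (fun x : Pt => f x.1 + c x.2.2 • k x.1) = fun _ => 0 := by
  funext x
  rw [pd, (hasFDerivAt_separated hf hk hc x).fderiv]
  simp [columnsDiff, e2]

theorem pd_e3_separated (hf : ∀ t, HasDerivAt f (f' t) t) (hk : ∀ t, HasDerivAt k (k' t) t)
    (hc : ∀ t, HasDerivAt c (c' t) t) :
    pd e3 (fun x : Pt => f x.1 + c x.2.2 • k x.1) = fun x : Pt => c' x.2.2 • k x.1 := by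
  funext x
  rw [pd, (hasFDerivAt_separated hf hk hc x).fderiv]
  simp [columnsDiff, e3]

theorem norm_columnsDiff_le (v w : V3) : ‖columnsDiff v w‖ ≤ ‖v‖ + ‖w‖ := by
  refine ContinuousLinearMap.opNorm_le_bound _ (by positivity) fun x => ?_
  have h1 : ‖x.1‖ ≤ ‖x‖ := norm_fst_le x
  have h3 : ‖x.2.2‖ ≤ ‖x‖ := (norm_snd_le x.2).trans (norm_snd_le x)
  calc ‖columnsDiff v w x‖ = ‖x.1 • v + x.2.2 • w‖ := by simp [columnsDiff]
    _ ≤ ‖x.1‖ * ‖v‖ + ‖x.2.2‖ * ‖w‖ := by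
      refine (norm_add_le _ _).trans ?_
      rw [norm_smul, norm_smul]
    _ ≤ ‖x‖ * ‖v‖ + ‖x‖ * ‖w‖ := by gcongr
    _ = (‖v‖ + ‖w‖) * ‖x‖ := by ring

theorem columnsDiff_sub (v w v' w' : V3) :
    columnsDiff v w - columnsDiff v' w' = columnsDiff (v - v') (w - w') := by
  ext y <;> simp [columnsDiff]

theorem continuous_columnsDiff {P Q : Pt → V3} (hP : Continuous P) (hQ : Continuous Q) :
    Continuous fun x => columnsDiff (P x) (Q x) := by
  unfold columnsDiff
  exact (((ContinuousLinearMap.smulRightL ℝ Pt V3 _).continuous.comp hP)).add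
    ((ContinuousLinearMap.smulRightL ℝ Pt V3 _).continuous.comp hQ)

theorem lipschitz_columnsDiff {P Q : Pt → V3} {K L : ℝ≥0} (hP : LipschitzWith K P)
    (hQ : LipschitzWith L Q) : LipschitzWith (K + L) fun x => columnsDiff (P x) (Q x) := by
  refine LipschitzWith.of_dist_le_mul fun x y => ?_
  rw [dist_eq_norm, columnsDiff_sub]
  refine (norm_columnsDiff_le _ _).trans ?_
  have h1 := hP.dist_le_mul x y
  have h2 := hQ.dist_le_mul x y
  rw [dist_eq_norm] at h1 h2
  push_cast
  linarith

theorem lipschitz_separated (hf : ∀ t, HasDerivAt f (f' t) t)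
    (hk : ∀ t, HasDerivAt k (k' t) t) (hc : ∀ t, HasDerivAt c (c' t) t)
    (bf' : ∃ M, ∀ t, ‖f' t‖ ≤ M) (bk : ∃ M, ∀ t, ‖k t‖ ≤ M) (bk' : ∃ M, ∀ t, ‖k' t‖ ≤ M)
    (bc : ∃ M, ∀ t, ‖c t‖ ≤ M) (bc' : ∃ M, ∀ t, ‖c' t‖ ≤ M) :
    ∃ K, LipschitzWith K fun x : Pt => f x.1 + c x.2.2 • k x.1 := by
  obtain ⟨M₁, h₁⟩ := bf'
  obtain ⟨M₂, h₂⟩ := bk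
  obtain ⟨M₃, h₃⟩ := bk'
  obtain ⟨M₄, h₄⟩ := bc
  obtain ⟨M₅, h₅⟩ := bc'
  refine ⟨(M₁ + M₄ * M₃ + M₅ * M₂).toNNReal, lipschitzWith_of_nnnorm_fderiv_le (𝕜 := ℝ)
    (fun x => (hasFDerivAt_separated hf hk hc x).differentiableAt) fun x => ?_⟩
  rw [(hasFDerivAt_separated hf hk hc x).fderiv, ← NNReal.coe_le_coe, coe_nnnorm]
  refine (norm_columnsDiff_le _ _).trans (le_trans ?_ (Real.le_coe_toNNReal _))
  have e₁ : ‖c x.2.2 • k' x.1‖ ≤ M₄ * M₃ := by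
    rw [norm_smul]
    exact mul_le_mul (h₄ _) (h₃ _) (norm_nonneg _) ((norm_nonneg _).trans (h₄ 0))
  have e₂ : ‖c' x.2.2 • k x.1‖ ≤ M₅ * M₂ := by
    rw [norm_smul]
    exact mul_le_mul (h₅ _) (h₂ _) (norm_nonneg _) ((norm_nonneg _).trans (h₅ 0))
  have := norm_add_le (f' x.1) (c x.2.2 • k' x.1)
  linarith [h₁ x.1]

end SeparatedMap

section RecoveryMap

/-- A compactly supported smooth function agreeing with the identity on `I`. -/
structure IsCutoff (χ : ℝ → ℝ) : Prop where
  contDiff : ContDiff ℝ 2 χ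
  hasCompactSupport : HasCompactSupport χ
  eqOn : ∀ z ∈ II, χ z = z

theorem exists_isCutoff : ∃ χ, IsCutoff χ := by
  let g : ContDiffBump (0 : ℝ) := ⟨1, 2, one_pos, one_lt_two⟩
  refine ⟨fun z => z * g z, contDiff_id.mul g.contDiff, g.hasCompactSupport.mul_left,
    fun z hz => ?_⟩
  rw [g.one_of_mem_closedBall, mul_one]
  rw [mem_closedBall_zero_iff, Real.norm_eq_abs, abs_le]
  change -(1 : ℝ) ≤ z ∧ z ≤ 1
  constructor <;> linarith [hz.1, hz.2]

variable {χ : ℝ → ℝ}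

theorem IsCutoff.deriv_eqOn (hχ : IsCutoff χ) : ∀ z ∈ II, deriv χ z = 1 := by
  intro z hz
  have : χ =ᶠ[𝓝 z] id := by
    filter_upwards [isOpen_Ioo.mem_nhds hz] with y hy using hχ.eqOn y hy
  rw [this.deriv_eq, deriv_id]

theorem IsCutoff.deriv_deriv_eqOn (hχ : IsCutoff χ) : ∀ z ∈ II, deriv (deriv χ) z = 0 := by
  intro z hz
  have : deriv χ =ᶠ[𝓝 z] fun _ => 1 := by
    filter_upwards [isOpen_Ioo.mem_nhds hz] with y hy using hχ.deriv_eqOn y hy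
  rw [this.deriv_eq, deriv_const]

theorem ContDiff.two_hasDerivAt {E : Type*} [NormedAddCommGroup E] [NormedSpace ℝ E]
    {f : ℝ → E} (hf : ContDiff ℝ 2 f) :
    (∀ t, HasDerivAt f (deriv f t) t) ∧ (∀ t, HasDerivAt (deriv f) (deriv (deriv f) t) t) ∧
      Continuous (deriv f) ∧ Continuous (deriv (deriv f)) := by
  have h1 : ContDiff ℝ 1 (deriv f) := by
    have : ContDiff ℝ (1 + 1) f := by simpa [one_add_one_eq_two] using hf
    exact (contDiff_succ_iff_deriv.1 this).2.2
  exact ⟨fun t => (hf.differentiable two_ne_zero t).hasDerivAt,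
    fun t => (h1.differentiable one_ne_zero t).hasDerivAt, h1.continuous,
    h1.continuous_deriv le_rfl⟩

/-- The pair `(φ₁, φ₂)` is a `C²` transition between the wells. -/
structure IsProfile (φ₁ φ₂ : ℝ → V3) (a b : V3) (ℓ : ℝ) : Prop where
  nonneg : 0 ≤ ℓ
  contDiff₁ : ContDiff ℝ 2 φ₁
  contDiff₂ : ContDiff ℝ 2 φ₂
  transition₁ : IsTransition φ₁ a ℓ
  transition₂ : IsTransition φ₂ b ℓ

/-- `v₀ + ∫₀^{x₁} g + h x₃ b(x₁)` for the ladders `g`, `b` of the two profiles, with `x₃` cut off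
at infinity. -/
noncomputable def recoveryMap (σ : ℝ) {m : ℕ} (α : Fin m → ℝ) (ε h : ℝ) (χ : ℝ → ℝ)
    (φ₁ φ₂ : ℝ → V3) (a b v₀ : V3) (x : Pt) : V3 :=
  (v₀ + ∫ s in (0 : ℝ)..x.1, ladder σ α ε φ₁ a s)
    + (h * χ x.2.2) • ladder σ α ε φ₂ b x.1

variable {σ : ℝ} {m : ℕ} {α : Fin m → ℝ} {ε h ℓ : ℝ} {φ₁ φ₂ : ℝ → V3} {a b v₀ : V3}

theorem ladder_continuous {Φ : ℝ → V3} (hΦ : Continuous Φ) (e : V3) :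
    Continuous (ladder σ α ε Φ e) :=
  continuous_const.add (layerSum_continuous hΦ 0)

theorem primitive_ladder_hasDerivAt {Φ : ℝ → V3} (hΦ : Continuous Φ) (e v₀ : V3) (t : ℝ) :
    HasDerivAt (fun t => v₀ + ∫ s in (0 : ℝ)..t, ladder σ α ε Φ e s) (ladder σ α ε Φ e t) t := by
  have hc : Continuous (ladder σ α ε Φ e) := ladder_continuous hΦ e
  exact (intervalIntegral.integral_hasDerivAt_right (hc.intervalIntegrable _ _)
    hc.stronglyMeasurable.stronglyMeasurableAtFilter hc.continuousAt).const_add v₀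

theorem recoveryMap_hasFDerivAt (hφ : IsProfile φ₁ φ₂ a b ℓ) (hχ : IsCutoff χ) (x : Pt) :
    HasFDerivAt (recoveryMap σ α ε h χ φ₁ φ₂ a b v₀)
      (columnsDiff (ladder σ α ε φ₁ a x.1 + (h * χ x.2.2) • layerSum σ α ε 1 (deriv φ₂) x.1)
        ((h * deriv χ x.2.2) • ladder σ α ε φ₂ b x.1)) x :=
  hasFDerivAt_separated (primitive_ladder_hasDerivAt hφ.contDiff₁.continuous a v₀)
    (ladder_hasDerivAt hφ.contDiff₂.two_hasDerivAt.1 b)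
    (fun t => (hχ.contDiff.two_hasDerivAt.1 t).const_mul h) x

theorem pd_e1_recoveryMap (hφ : IsProfile φ₁ φ₂ a b ℓ) (hχ : IsCutoff χ) :
    pd e1 (recoveryMap σ α ε h χ φ₁ φ₂ a b v₀) = fun x => ladder σ α ε φ₁ a x.1
      + (h * χ x.2.2) • layerSum σ α ε 1 (deriv φ₂) x.1 :=
  pd_e1_separated (primitive_ladder_hasDerivAt hφ.contDiff₁.continuous a v₀)
    (ladder_hasDerivAt hφ.contDiff₂.two_hasDerivAt.1 b)
    (fun t => (hχ.contDiff.two_hasDerivAt.1 t).const_mul h)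

theorem pd_e2_recoveryMap (hφ : IsProfile φ₁ φ₂ a b ℓ) (hχ : IsCutoff χ) :
    pd e2 (recoveryMap σ α ε h χ φ₁ φ₂ a b v₀) = fun _ => 0 :=
  pd_e2_separated (primitive_ladder_hasDerivAt hφ.contDiff₁.continuous a v₀)
    (ladder_hasDerivAt hφ.contDiff₂.two_hasDerivAt.1 b)
    (fun t => (hχ.contDiff.two_hasDerivAt.1 t).const_mul h)

theorem pd_e3_recoveryMap (hφ : IsProfile φ₁ φ₂ a b ℓ) (hχ : IsCutoff χ) :
    pd e3 (recoveryMap σ α ε h χ φ₁ φ₂ a b v₀)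
      = fun x => (h * deriv χ x.2.2) • ladder σ α ε φ₂ b x.1 :=
  pd_e3_separated (primitive_ladder_hasDerivAt hφ.contDiff₁.continuous a v₀)
    (ladder_hasDerivAt hφ.contDiff₂.two_hasDerivAt.1 b)
    (fun t => (hχ.contDiff.two_hasDerivAt.1 t).const_mul h)

theorem pd_zero (e : Pt) : pd e (fun _ => 0) = fun _ => 0 := by
  funext x
  simp [pd]

theorem hessh_recoveryMap (hφ : IsProfile φ₁ φ₂ a b ℓ) (hχ : IsCutoff χ) (hh : h ≠ 0)
    {x : Pt} (hx : x.2.2 ∈ II) :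
    hessh h (recoveryMap σ α ε h χ φ₁ φ₂ a b v₀) x
      = vnorm (layerSum σ α ε 1 (deriv φ₁) x.1
          + (h * x.2.2) • layerSum σ α ε 2 (deriv (deriv φ₂)) x.1) ^ 2
        + 2 * vnorm (layerSum σ α ε 1 (deriv φ₂) x.1) ^ 2 := by
  have d₁ := hφ.contDiff₁.two_hasDerivAt
  have d₂ := hφ.contDiff₂.two_hasDerivAt
  have dχ := hχ.contDiff.two_hasDerivAt
  have hf := ladder_hasDerivAt (σ := σ) (α := α) (ε := ε) d₁.1 a
  have hk := layerSum_hasDerivAt (σ := σ) (α := α) (ε := ε) d₂.2.1 1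
  have hc := fun t => (dχ.1 t).const_mul h
  have h33 : pd e3 (fun x : Pt => (h * deriv χ x.2.2) • ladder σ α ε φ₂ b x.1)
      = fun x : Pt => (h * deriv (deriv χ) x.2.2) • ladder σ α ε φ₂ b x.1 := by
    have := pd_e3_separated (fun t => hasDerivAt_const t (0 : V3))
      (ladder_hasDerivAt (σ := σ) (α := α) (ε := ε) d₂.1 b) (fun t => (dχ.2.1 t).const_mul h)
    simpa only [zero_add] using this
  unfold hessh
  rw [pd_e1_recoveryMap hφ hχ, pd_e2_recoveryMap hφ hχ, pd_e3_recoveryMap hφ hχ,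
    pd_e1_separated hf hk hc, pd_e2_separated hf hk hc, pd_e3_separated hf hk hc, pd_zero,
    pd_zero, h33]
  simp only [hχ.deriv_deriv_eqOn _ hx, hχ.deriv_eqOn _ hx, hχ.eqOn _ hx, vnorm_zero, mul_zero,
    zero_smul, mul_one, vnorm_smul, mul_pow, sq_abs]
  field_simp
  ring

theorem gradh_recoveryMap (hφ : IsProfile φ₁ φ₂ a b ℓ) (hχ : IsCutoff χ) (hh : h ≠ 0)
    {x : Pt} (hx : x.2.2 ∈ II) :
    gradh h (recoveryMap σ α ε h χ φ₁ φ₂ a b v₀) x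
      = ![ladder σ α ε φ₁ a x.1 + (h * x.2.2) • layerSum σ α ε 1 (deriv φ₂) x.1, 0,
        ladder σ α ε φ₂ b x.1] := by
  unfold gradh
  rw [pd_e1_recoveryMap hφ hχ, pd_e2_recoveryMap hφ hχ, pd_e3_recoveryMap hφ hχ]
  simp only [hχ.deriv_eqOn _ hx, hχ.eqOn _ hx, mul_one, smul_smul, inv_mul_cancel₀ hh, one_smul]

theorem recoveryMap_contDiff (hφ : IsProfile φ₁ φ₂ a b ℓ) (hχ : IsCutoff χ) :
    ContDiff ℝ 1 (recoveryMap σ α ε h χ φ₁ φ₂ a b v₀) := by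
  rw [contDiff_one_iff_fderiv]
  refine ⟨fun x => (recoveryMap_hasFDerivAt hφ hχ x).differentiableAt, ?_⟩
  have : fderiv ℝ (recoveryMap σ α ε h χ φ₁ φ₂ a b v₀) = _ :=
    funext fun x => (recoveryMap_hasFDerivAt hφ hχ x).fderiv
  rw [this]
  have k₁ : Continuous (ladder σ α ε φ₁ a) := ladder_continuous hφ.contDiff₁.continuous a
  have k₂ : Continuous (ladder σ α ε φ₂ b) := ladder_continuous hφ.contDiff₂.continuous b
  have k₃ : Continuous (layerSum σ α ε 1 (deriv φ₂)) :=
    layerSum_continuous hφ.contDiff₂.two_hasDerivAt.2.2.1 1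
  have k₄ := hχ.contDiff.continuous
  have k₅ := hχ.contDiff.two_hasDerivAt.2.2.1
  refine continuous_columnsDiff ?_ ?_ <;> fun_prop

theorem recoveryMap_fderiv_lipschitz (hφ : IsProfile φ₁ φ₂ a b ℓ) (hχ : IsCutoff χ)
    (hσ : σ = 1 ∨ σ = -1) (hε : 0 < ε) :
    ∃ K, LipschitzWith K (fderiv ℝ (recoveryMap σ α ε h χ φ₁ φ₂ a b v₀)) := by
  have d₁ := hφ.contDiff₁.two_hasDerivAt
  have d₂ := hφ.contDiff₂.two_hasDerivAt
  have dχ := hχ.contDiff.two_hasDerivAt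
  have cutoff_bound : ∀ {g : ℝ → ℝ}, Continuous g → HasCompactSupport g →
      ∃ M, ∀ t, ‖h * g t‖ ≤ M := fun hg hs => by
    obtain ⟨M, hM⟩ := hs.exists_bound_of_continuous hg
    exact ⟨‖h‖ * M, fun t => by rw [norm_mul]; gcongr; exact hM t⟩
  have layer_bound : ∀ {g : ℝ → V3} (k : ℕ), Continuous g → (∀ t, ℓ < |t| → g t = 0) →
      ∃ M, ∀ t, ‖layerSum σ α ε k g t‖ ≤ M := fun k hg h0 => by
    obtain ⟨M, -, hM⟩ := exists_bound_of_eq_zero hg h0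
    exact ⟨_, norm_layerSum_le hσ hε hM k⟩
  have s₁ := hχ.hasCompactSupport
  have s₂ := s₁.deriv
  have s₃ := s₂.deriv
  have b₂ : ∃ M, ∀ t, ‖layerSum σ α ε 1 (deriv φ₂) t‖ ≤ M :=
    layer_bound 1 d₂.2.2.1 fun t ht => hφ.transition₂.deriv_eq_zero ht
  have bL : ∃ M, ∀ t, ‖ladder σ α ε φ₂ b t‖ ≤ M := by
    obtain ⟨M, -, hM⟩ := hφ.transition₂.exists_bound hφ.contDiff₂.continuous
    exact ⟨_, norm_ladder_le hσ hε hM⟩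
  obtain ⟨K, hK⟩ := lipschitz_separated (ladder_hasDerivAt (σ := σ) (α := α) (ε := ε) d₁.1 a)
    (layerSum_hasDerivAt (σ := σ) (α := α) (ε := ε) d₂.2.1 1) (fun t => (dχ.1 t).const_mul h)
    (layer_bound 1 d₁.2.2.1 fun t ht => hφ.transition₁.deriv_eq_zero ht) b₂
    (layer_bound 2 d₂.2.2.2 fun t ht => hφ.transition₂.deriv_deriv_eq_zero ht)
    (cutoff_bound hχ.contDiff.continuous s₁) (cutoff_bound dχ.2.2.1 s₂)
  obtain ⟨L, hL⟩ := lipschitz_separated (fun t => hasDerivAt_const t (0 : V3))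
    (ladder_hasDerivAt (σ := σ) (α := α) (ε := ε) d₂.1 b) (fun t => (dχ.2.1 t).const_mul h)
    ⟨0, by simp⟩ bL b₂ (cutoff_bound dχ.2.2.1 s₂) (cutoff_bound dχ.2.2.2 s₃)
  simp only [zero_add] at hL
  have : fderiv ℝ (recoveryMap σ α ε h χ φ₁ φ₂ a b v₀) = _ :=
    funext fun x => (recoveryMap_hasFDerivAt hφ hχ x).fderiv
  exact ⟨K + L, this ▸ lipschitz_columnsDiff hK hL⟩

/-- The energy density at the layer coordinate `τ` and height `z`, for the signed ratio `r` of
thickness and layer width. -/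
noncomputable def layerDensity (W : M33 → ℝ) (φ₁ φ₂ : ℝ → V3) (q : ℝ × ℝ × ℝ) : ℝ :=
  W ![φ₁ q.2.1 + (q.1 * q.2.2) • deriv φ₂ q.2.1, 0, φ₂ q.2.1]
    + vnorm (deriv φ₁ q.2.1 + (q.1 * q.2.2) • deriv (deriv φ₂) q.2.1) ^ 2
    + 2 * vnorm (deriv φ₂ q.2.1) ^ 2

variable {W : M33 → ℝ}

theorem layerDensity_continuous (hW : Continuous W) (hφ : IsProfile φ₁ φ₂ a b ℓ) :
    Continuous (layerDensity W φ₁ φ₂) := by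
  have k₁ := hφ.contDiff₁.continuous
  have k₂ := hφ.contDiff₂.continuous
  obtain ⟨-, -, k₃, -⟩ := hφ.contDiff₁.two_hasDerivAt
  obtain ⟨-, -, k₄, k₅⟩ := hφ.contDiff₂.two_hasDerivAt
  have kv := continuous_vnorm
  unfold layerDensity
  refine Continuous.add (Continuous.add (hW.comp (continuous_pi fun i => ?_)) ?_) ?_
  · fin_cases i <;> simp <;> fun_prop
  · fun_prop
  · fun_prop

theorem layerDensity_eq_zero (hw : VanishesAtWells W a b) (hφ : IsProfile φ₁ φ₂ a b ℓ)
    {q : ℝ × ℝ × ℝ} (hq : ℓ < |q.2.1|) : layerDensity W φ₁ φ₂ q = 0 := by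
  rw [layerDensity, hφ.transition₁.deriv_eq_zero hq, hφ.transition₂.deriv_eq_zero hq,
    hφ.transition₂.deriv_deriv_eq_zero hq]
  simp [vnorm_zero, hw.eq_zero hφ.transition₁ hφ.transition₂ hq]

theorem layerDensity_nonneg (hW0 : ∀ ξ, 0 ≤ W ξ) (q : ℝ × ℝ × ℝ) :
    0 ≤ layerDensity W φ₁ φ₂ q := by
  have := hW0 ![φ₁ q.2.1 + (q.1 * q.2.2) • deriv φ₂ q.2.1, 0, φ₂ q.2.1]
  unfold layerDensity
  positivity

theorem energy_density_eq_sum (hw : VanishesAtWells W a b) (hφ : IsProfile φ₁ φ₂ a b ℓ)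
    (hχ : IsCutoff χ) (hσ : σ = 1 ∨ σ = -1) (hα : StrictMono α) (hε : 0 < ε) (hh : h ≠ 0)
    (hsep : ∀ t j, |t - α j| ≤ ε * ℓ → ∀ i, i ≠ j → ε * ℓ < |t - α i|)
    {x : Pt} (hx : x.2.2 ∈ II) :
    ε⁻¹ * W (gradh h (recoveryMap σ α ε h χ φ₁ φ₂ a b v₀) x)
        + ε * hessh h (recoveryMap σ α ε h χ φ₁ φ₂ a b v₀) x
      = ∑ i : Fin m, ε⁻¹ * layerDensity W φ₁ φ₂
          (interfaceSign σ i * (h / ε), layerCoord σ α ε i x.1, x.2.2) := by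
  have z₁ : ∀ τ, ℓ < |τ| → deriv φ₁ τ = 0 := fun τ => hφ.transition₁.deriv_eq_zero
  have z₂ : ∀ τ, ℓ < |τ| → deriv φ₂ τ = 0 := fun τ => hφ.transition₂.deriv_eq_zero
  have z₃ : ∀ τ, ℓ < |τ| → deriv (deriv φ₂) τ = 0 :=
    fun τ => hφ.transition₂.deriv_deriv_eq_zero
  rw [gradh_recoveryMap hφ hχ hh hx, hessh_recoveryMap hφ hχ hh hx]
  by_cases hfar : ∀ i, ε * ℓ < |x.1 - α i|
  · have hphase : W ![ladder σ α ε φ₁ a x.1, 0, ladder σ α ε φ₂ b x.1] = 0 := by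
      rw [ladder_eq_phase hφ.transition₁ hσ hα hε hφ.nonneg hfar,
        ladder_eq_phase hφ.transition₂ hσ hα hε hφ.nonneg hfar]
      have hs : σ * (-1) ^ cnt m α x.1 = 1 ∨ σ * (-1) ^ cnt m α x.1 = -1 := by
        rcases hσ with rfl | rfl <;> rcases neg_one_pow_eq_or ℝ (cnt m α x.1) with h | h <;>
          simp [h]
      rcases hs with hs | hs <;> rw [hs]
      · simpa using hw.pos
      · simpa using hw.neg
    rw [layerSum_eq_zero hσ hε z₁ hfar, layerSum_eq_zero hσ hε z₂ hfar,
      layerSum_eq_zero hσ hε z₃ hfar, Finset.sum_eq_zero fun i _ => by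
        rw [layerDensity_eq_zero hw hφ (lt_abs_layerCoord hσ hε (hfar i)), mul_zero]]
    simp [hphase, vnorm_zero]
  · push Not at hfar
    obtain ⟨j, hj⟩ := hfar
    have hne := hsep x.1 j hj
    rw [ladder_eq_layer hφ.transition₁ hσ hα hε hφ.nonneg hj hne,
      ladder_eq_layer hφ.transition₂ hσ hα hε hφ.nonneg hj hne,
      layerSum_eq_single hσ hε z₁ hne, layerSum_eq_single hσ hε z₂ hne,
      layerSum_eq_single hσ hε z₃ hne,
      Finset.sum_eq_single_of_mem j (Finset.mem_univ _) fun i _ hij => by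
        rw [layerDensity_eq_zero hw hφ (lt_abs_layerCoord hσ hε (hne i hij)), mul_zero]]
    unfold layerDensity
    set s := interfaceSign σ j with hs
    set τ := layerCoord σ α ε j x.1
    have hs2 : s ^ 2 = 1 := by rw [← sq_abs, hs, abs_interfaceSign hσ, one_pow]
    have r₁ : (h * x.2.2) • (s / ε) ^ 1 • deriv φ₂ τ
        = (s * (h / ε) * x.2.2) • deriv φ₂ τ := by
      rw [smul_smul]; congr 1; ring
    have r₂ : (s / ε) ^ 1 • deriv φ₁ τ + (h * x.2.2) • (s / ε) ^ 2 • deriv (deriv φ₂) τ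
        = (s / ε) • (deriv φ₁ τ + (s * (h / ε) * x.2.2) • deriv (deriv φ₂) τ) := by
      rw [smul_add, smul_smul, smul_smul, pow_one]; congr 2; ring
    rw [r₁, r₂, vnorm_smul, vnorm_smul, mul_pow, mul_pow, sq_abs, sq_abs, pow_one, div_pow, hs2]
    field_simp
    ring

end RecoveryMap

section LayerLimit

theorem lintegral_affine {K : ℝ → ℝ≥0∞} (hK : Measurable K) (α : ℝ) {c : ℝ} (hc : c ≠ 0) :
    ∫⁻ x, K x = ENNReal.ofReal |c| * ∫⁻ τ, K (α + c * τ) := by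
  have hKα : Measurable fun x => K (α + x) := hK.comp (measurable_const_add α)
  have hscale : ∫⁻ x, K (α + x) = ENNReal.ofReal |c| * ∫⁻ τ, K (α + c * τ) := by
    conv_lhs => rw [← Real.smul_map_volume_mul_left hc]
    rw [lintegral_smul_measure, lintegral_map hKα (measurable_const_mul c), smul_eq_mul]
  rw [← hscale, lintegral_add_left_eq_self]

theorem lintegral_affine_fst {f : Pt → ℝ≥0∞} (hf : Measurable f) (α : ℝ) {c : ℝ} (hc : c ≠ 0) :
    ∫⁻ x, f x = ENNReal.ofReal |c| * ∫⁻ y : Pt, f (α + c * y.1, y.2) := by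
  have hg : Measurable fun y : Pt => f (α + c * y.1, y.2) := hf.comp (by fun_prop)
  rw [Measure.volume_eq_prod, lintegral_prod _ hf.aemeasurable, lintegral_prod _ hg.aemeasurable]
  exact lintegral_affine hf.lintegral_prod_right' α hc

variable {ω : Set (ℝ × ℝ)}

theorem isOpen_Om (hωo : IsOpen ω) : IsOpen (Om ω) := by
  have h1 : Continuous fun x : Pt => (x.1, x.2.1) := by fun_prop
  have h2 : Continuous fun x : Pt => x.2.2 := by fun_prop
  exact (hωo.preimage h1).inter (isOpen_Ioo.preimage h2)

theorem exists_mem_slice (hωc : Convex ℝ ω) (hωne : ω.Nonempty) {α : ℝ}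
    (hα : sInf (Prod.fst '' ω) < α ∧ α < sSup (Prod.fst '' ω)) : ∃ t, (α, t) ∈ ω := by
  have hne : (Prod.fst '' ω).Nonempty := hωne.image _
  obtain ⟨x, hx, hxα⟩ := exists_lt_of_csInf_lt hne hα.1
  obtain ⟨y, hy, hyα⟩ := exists_lt_of_lt_csSup hne hα.2
  have hconv : Convex ℝ (Prod.fst '' ω) := hωc.linear_image (LinearMap.fst ℝ ℝ ℝ)
  obtain ⟨q, hq, hqα⟩ := hconv.ordConnected.out hx hy ⟨hxα.le, hyα.le⟩
  exact ⟨q.2, by rwa [← hqα]⟩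

theorem ae_slice_mem_or_notMem_closure (hωo : IsOpen ω) (hωc : Convex ℝ ω) {α : ℝ}
    (hα : ∃ t, (α, t) ∈ ω) : ∀ᵐ t : ℝ, (α, t) ∈ ω ∨ (α, t) ∉ closure ω := by
  obtain ⟨t₀, ht₀⟩ := hα
  set S : Set ℝ := {t | (α, t) ∈ ω} with hS
  have hSc : Convex ℝ S := by
    intro x hx y hy p q hp hq hpq
    have := hωc hx hy hp hq hpq
    have hα' : p * α + q * α = α := by rw [← add_mul, hpq, one_mul]
    simpa [hS, hα'] using this
  have hnull := hSc.addHaar_frontier (volume : Measure ℝ)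
  filter_upwards [compl_mem_ae_iff.2 hnull] with t ht
  by_contra! hcon
  refine ht ?_
  have hseg : openSegment ℝ t₀ t ⊆ S := by
    rintro _ ⟨p, q, hp, hq, hpq, rfl⟩
    have hmem : p • (α, t₀) + q • (α, t) ∈ interior ω :=
      hωc.combo_interior_closure_mem_interior (by rwa [hωo.interior_eq]) hcon.2 hp hq.le hpq
    have hα' : p * α + q * α = α := by rw [← add_mul, hpq, one_mul]
    simpa [hS, hα'] using interior_subset hmem
  rw [frontier_eq_closure_inter_closure]
  exact ⟨closure_mono hseg (segment_subset_closure_openSegment (right_mem_segment ℝ t₀ t)),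
    subset_closure hcon.1⟩

theorem tendsto_layer_energy (hωo : IsOpen ω) (hωc : Convex ℝ ω)
    (hωb : Bornology.IsBounded ω) {α : ℝ} (hα : ∃ t, (α, t) ∈ ω)
    {H : ℝ × ℝ × ℝ → ℝ} (hH : Continuous H) {ℓ : ℝ}
    (hH0 : ∀ q, ℓ < |q.2.1| → H q = 0) (hHz : ∀ τ z, H (0, τ, z) = H (0, τ, 0))
    {s : ℝ} (hs : |s| = 1) {ε r : ℕ → ℝ} (hε : ∀ n, 0 < ε n) (hε0 : Tendsto ε atTop (𝓝 0))
    (hr : Tendsto r atTop (𝓝 0)) :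
    Tendsto (fun n => ∫⁻ x in Om ω,
        ENNReal.ofReal ((ε n)⁻¹ * H (r n, s / ε n * (x.1 - α), x.2.2))) atTop
      (𝓝 ((∫⁻ τ, ENNReal.ofReal (H (0, τ, 0))) * volume {t : ℝ | (α, t) ∈ ω})) := by
  have hOm := (isOpen_Om hωo).measurableSet
  have hs2 : s * s = 1 := by rw [← abs_mul_abs_self, hs, one_mul]
  let T : ℕ → Pt → Pt := fun n y => (α + ε n * s * y.1, y.2)
  have hT : ∀ n, Measurable (T n) := fun n => by fun_prop
  have hrescale : ∀ n, ∫⁻ x in Om ω,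
        ENNReal.ofReal ((ε n)⁻¹ * H (r n, s / ε n * (x.1 - α), x.2.2))
      = ∫⁻ y : Pt, (T n ⁻¹' Om ω).indicator
        (fun y => ENNReal.ofReal (H (r n, y.1, y.2.2))) y := by
    intro n
    have hne : ε n * s ≠ 0 := mul_ne_zero (hε n).ne' fun h => by simp [h] at hs
    have hmeas : Measurable fun x : Pt =>
        ENNReal.ofReal ((ε n)⁻¹ * H (r n, s / ε n * (x.1 - α), x.2.2)) := by
      have : Continuous fun x : Pt => (ε n)⁻¹ * H (r n, s / ε n * (x.1 - α), x.2.2) := by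
        fun_prop
      exact this.measurable.ennreal_ofReal
    rw [← lintegral_indicator hOm, lintegral_affine_fst (hmeas.indicator hOm) α hne,
      ← lintegral_const_mul' _ _ ENNReal.ofReal_ne_top]
    refine lintegral_congr fun y => ?_
    by_cases hy : T n y ∈ Om ω
    · rw [indicator_of_mem (show (α + ε n * s * y.1, y.2) ∈ Om ω from hy),
        indicator_of_mem (mem_preimage.2 hy), abs_mul, hs, mul_one, abs_of_pos (hε n),
        ← ENNReal.ofReal_mul (hε n).le, ← mul_assoc, mul_inv_cancel₀ (hε n).ne', one_mul]
      have : s / ε n * (α + ε n * s * y.1 - α) = y.1 := by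
        rw [add_sub_cancel_left]
        calc s / ε n * (ε n * s * y.1) = (s * s) * (ε n / ε n) * y.1 := by ring
          _ = y.1 := by rw [hs2, div_self (hε n).ne', one_mul, one_mul]
      simp only [this]
    · rw [indicator_of_notMem (show (α + ε n * s * y.1, y.2) ∉ Om ω from hy),
        indicator_of_notMem (by simpa using hy), mul_zero]
  simp only [hrescale]
  have hJo : IsOpen {t : ℝ | (α, t) ∈ ω} := hωo.preimage (by fun_prop)
  have hlimit : (∫⁻ τ, ENNReal.ofReal (H (0, τ, 0))) * volume {t : ℝ | (α, t) ∈ ω}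
      = ∫⁻ y : Pt, {y : Pt | (α, y.2.1) ∈ ω ∧ y.2.2 ∈ II}.indicator
        (fun y => ENNReal.ofReal (H (0, y.1, y.2.2))) y := by
    have hsplit : ∀ y : Pt, {y : Pt | (α, y.2.1) ∈ ω ∧ y.2.2 ∈ II}.indicator
        (fun y => ENNReal.ofReal (H (0, y.1, y.2.2))) y
        = ENNReal.ofReal (H (0, y.1, 0)) *
          ({t : ℝ | (α, t) ∈ ω} ×ˢ II).indicator 1 y.2 := by
      intro y
      by_cases hy : (α, y.2.1) ∈ ω ∧ y.2.2 ∈ II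
      · rw [indicator_of_mem (show y ∈ {y : Pt | (α, y.2.1) ∈ ω ∧ y.2.2 ∈ II} from hy),
          indicator_of_mem (mem_prod.2 hy), hHz]
        simp
      · rw [indicator_of_notMem (show y ∉ {y : Pt | (α, y.2.1) ∈ ω ∧ y.2.2 ∈ II} from hy),
          indicator_of_notMem (fun h => hy (mem_prod.1 h)), mul_zero]
    simp only [hsplit]
    have hm : MeasurableSet ({t : ℝ | (α, t) ∈ ω} ×ˢ II) :=
      hJo.measurableSet.prod measurableSet_Ioo
    have hHm : Measurable fun τ => ENNReal.ofReal (H (0, τ, 0)) := by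
      have : Continuous fun τ => H (0, τ, 0) := by fun_prop
      exact this.measurable.ennreal_ofReal
    have hI : volume II = 1 := by
      rw [II, Real.volume_Ioo]; norm_num
    have h1m : Measurable (({t : ℝ | (α, t) ∈ ω} ×ˢ II).indicator (1 : ℝ × ℝ → ℝ≥0∞)) :=
      measurable_one.indicator hm
    rw [Measure.volume_eq_prod, lintegral_prod_mul hHm.aemeasurable h1m.aemeasurable,
      lintegral_indicator_one hm, Measure.volume_eq_prod ℝ ℝ, Measure.prod_prod, hI, mul_one]
  rw [hlimit]
  obtain ⟨R, hR⟩ := hωb.exists_norm_le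
  let box : Set (ℝ × ℝ × ℝ) := Icc (-1) 1 ×ˢ (Icc (-ℓ) ℓ ×ˢ Icc (-1) 1)
  have hbox : IsCompact box := isCompact_Icc.prod (isCompact_Icc.prod isCompact_Icc)
  obtain ⟨C, hC⟩ := hbox.exists_bound_of_continuousOn hH.continuousOn
  let region : Set Pt := Icc (-ℓ) ℓ ×ˢ (Icc (-R) R ×ˢ Icc (-1) 1)
  have hregion : MeasurableSet region :=
    measurableSet_Icc.prod (measurableSet_Icc.prod measurableSet_Icc)
  have hII : ∀ z ∈ II, z ∈ Icc (-1 : ℝ) 1 := fun z hz =>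
    ⟨by linarith [hz.1], by linarith [hz.2]⟩
  refine tendsto_lintegral_filter_of_dominated_convergence
    (region.indicator fun _ => ENNReal.ofReal C) ?_ ?_ ?_ ?_
  · refine Eventually.of_forall fun n => Measurable.indicator ?_ (hT n hOm)
    have : Continuous fun y : Pt => H (r n, y.1, y.2.2) := by fun_prop
    exact this.measurable.ennreal_ofReal
  · filter_upwards [hr.eventually (Icc_mem_nhds (by norm_num : (-1 : ℝ) < 0) one_pos)]
      with n hn
    refine Eventually.of_forall fun y => ?_
    by_cases hy : T n y ∈ Om ω
    · rw [indicator_of_mem (mem_preimage.2 hy)]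
      by_cases hτ : ℓ < |y.1|
      · rw [hH0 _ hτ]; simp
      · have hy1 : y.1 ∈ Icc (-ℓ) ℓ := abs_le.1 (not_lt.1 hτ)
        have hy2 : y.2.1 ∈ Icc (-R) R := by
          rw [mem_Icc, ← abs_le]
          exact (norm_snd_le ((T n y).1, y.2.1)).trans (hR _ hy.1)
        have hy3 := hII _ hy.2
        rw [indicator_of_mem (show y ∈ region from ⟨hy1, hy2, hy3⟩)]
        exact ENNReal.ofReal_le_ofReal
          ((le_abs_self _).trans (hC (r n, y.1, y.2.2) ⟨hn, hy1, hy3⟩))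
    · rw [indicator_of_notMem (by simpa using hy)]
      exact zero_le
  · rw [lintegral_indicator hregion, setLIntegral_const]
    refine ENNReal.mul_ne_top ENNReal.ofReal_ne_top ?_
    exact (isCompact_Icc.prod (isCompact_Icc.prod isCompact_Icc)).measure_lt_top.ne
  · have hae : ∀ᵐ y : Pt, (α, y.2.1) ∈ ω ∨ (α, y.2.1) ∉ closure ω := by
      have h1 : ∀ᵐ w : ℝ × ℝ, (α, w.1) ∈ ω ∨ (α, w.1) ∉ closure ω :=
        Measure.quasiMeasurePreserving_fst.ae (ae_slice_mem_or_notMem_closure hωo hωc hα)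
      exact Measure.quasiMeasurePreserving_snd.ae h1
    filter_upwards [hae] with y hy
    have hTy : Tendsto (fun n => ((T n y).1, y.2.1)) atTop (𝓝 (α, y.2.1)) := by
      refine Tendsto.prodMk_nhds ?_ tendsto_const_nhds
      have : Tendsto (fun n => α + ε n * s * y.1) atTop (𝓝 (α + 0 * s * y.1)) :=
        ((hε0.mul_const s).mul_const y.1).const_add α
      simpa using this
    by_cases hz : y.2.2 ∈ II
    · rcases hy with hin | hout
      · rw [indicator_of_mem (show y ∈ {y : Pt | (α, y.2.1) ∈ ω ∧ y.2.2 ∈ II} from ⟨hin, hz⟩)]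
        have hlim : Tendsto (fun n => ENNReal.ofReal (H (r n, y.1, y.2.2))) atTop
            (𝓝 (ENNReal.ofReal (H (0, y.1, y.2.2)))) := by
          refine (ENNReal.continuous_ofReal.tendsto _).comp ((hH.tendsto _).comp ?_)
          exact hr.prodMk_nhds tendsto_const_nhds
        refine hlim.congr' ?_
        filter_upwards [hTy.eventually (hωo.mem_nhds hin)] with n hn
        rw [indicator_of_mem (show y ∈ T n ⁻¹' Om ω from ⟨hn, hz⟩)]
      · rw [indicator_of_notMem (show y ∉ {y : Pt | (α, y.2.1) ∈ ω ∧ y.2.2 ∈ II} from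
          fun h => hout (subset_closure h.1))]
        refine tendsto_const_nhds.congr' ?_
        filter_upwards [hTy.eventually (isClosed_closure.isOpen_compl.mem_nhds hout)] with n hn
        rw [indicator_of_notMem (show y ∉ T n ⁻¹' Om ω from fun h => hn (subset_closure h.1))]
    · rw [indicator_of_notMem (show y ∉ {y : Pt | (α, y.2.1) ∈ ω ∧ y.2.2 ∈ II} from
        fun h => hz h.2)]
      refine tendsto_const_nhds.congr fun n => ?_
      rw [indicator_of_notMem (show y ∉ T n ⁻¹' Om ω from fun h => hz h.2)]

end LayerLimit

section LpConvergence

theorem tendsto_lintegral_vnorm_rpow {p : ℝ} (hp : 0 < p) {S : Set Pt} (hS : MeasurableSet S)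
    (hfin : volume S ≠ ⊤) {f : ℕ → Pt → V3} (hm : ∀ n, Measurable (f n)) {C : ℝ}
    (hC : ∀ᶠ n in atTop, ∀ x ∈ S, ‖f n x‖ ≤ C)
    (hf : ∀ᵐ x, x ∈ S → Tendsto (fun n => f n x) atTop (𝓝 0)) :
    Tendsto (fun n => ∫⁻ x in S, ENNReal.ofReal (vnorm (f n x) ^ p)) atTop (𝓝 0) := by
  have hcont : Continuous fun v : V3 => ENNReal.ofReal (vnorm v ^ p) :=
    ENNReal.continuous_ofReal.comp (continuous_vnorm.rpow_const fun _ => Or.inr hp.le)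
  have hzero : ENNReal.ofReal (vnorm 0 ^ p) = 0 := by
    rw [vnorm_zero, Real.zero_rpow hp.ne', ENNReal.ofReal_zero]
  have := tendsto_lintegral_filter_of_dominated_convergence (μ := volume.restrict S)
    (F := fun n x => ENNReal.ofReal (vnorm (f n x) ^ p)) (f := fun _ => 0)
    (fun _ => ENNReal.ofReal ((2 * C) ^ p)) (l := atTop)
    (Eventually.of_forall fun n => hcont.measurable.comp (hm n)) ?_ ?_ ?_
  · simpa using this
  · filter_upwards [hC] with n hn
    refine (ae_restrict_mem hS).mono fun x hx => ENNReal.ofReal_le_ofReal ?_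
    refine Real.rpow_le_rpow (vnorm_nonneg _) ?_ hp.le
    exact (vnorm_le _).trans (by linarith [hn x hx])
  · rw [setLIntegral_const]
    exact ENNReal.mul_ne_top ENNReal.ofReal_ne_top hfin
  · filter_upwards [ae_restrict_mem hS, ae_restrict_of_ae hf] with x hx hfx
    exact hzero ▸ (hcont.tendsto 0).comp (hfx hx)

variable {σ : ℝ} {m : ℕ} {α : Fin m → ℝ}

theorem measurable_phase (σ : ℝ) (α : Fin m → ℝ) (e : V3) :
    Measurable fun t => (σ * (-1) ^ cnt m α t) • e := by
  have hmono : Monotone (cnt m α) := fun s t hst => Finset.card_le_card fun i hi => by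
    simp only [Finset.mem_filter, Finset.mem_univ, true_and] at hi ⊢
    exact hi.trans_le hst
  have : Measurable fun k : ℕ => (σ * (-1 : ℝ) ^ k) • e := measurable_of_countable _
  exact this.comp hmono.measurable

theorem norm_phase_le (hσ : σ = 1 ∨ σ = -1) (e : V3) (k : ℕ) :
    ‖(σ * (-1) ^ k) • e‖ ≤ ‖e‖ := by
  rcases hσ with rfl | rfl <;> simp [norm_smul]

theorem ae_fst_notMem_range (α : Fin m → ℝ) : ∀ᵐ x : Pt, x.1 ∉ range α :=
  Measure.quasiMeasurePreserving_fst.ae ((finite_range α).countable.ae_notMem volume)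

variable {ε : ℕ → ℝ} {ℓ : ℝ}

theorem ladder_eventually_eq_phase {Φ : ℝ → V3} {e : V3} (hΦ : IsTransition Φ e ℓ)
    (hσ : σ = 1 ∨ σ = -1) (hα : StrictMono α) (hε : ∀ n, 0 < ε n)
    (hε0 : Tendsto ε atTop (𝓝 0)) (hℓ : 0 ≤ ℓ) {t : ℝ} (ht : t ∉ range α) :
    ∀ᶠ n in atTop, ladder σ α (ε n) Φ e t = (σ * (-1) ^ cnt m α t) • e := by
  filter_upwards [eventually_far hε0 ℓ ht] with n hn
  exact ladder_eq_phase hΦ hσ hα (hε n) hℓ hn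

theorem layerSum_eventually_eq_zero {Ψ : ℝ → V3} (hΨ : ∀ τ, ℓ < |τ| → Ψ τ = 0)
    (hσ : σ = 1 ∨ σ = -1) (hε : ∀ n, 0 < ε n) (hε0 : Tendsto ε atTop (𝓝 0)) (k : ℕ) {t : ℝ}
    (ht : t ∉ range α) : ∀ᶠ n in atTop, layerSum σ α (ε n) k Ψ t = 0 := by
  filter_upwards [eventually_far hε0 ℓ ht] with n hn
  exact layerSum_eq_zero hσ (hε n) hΨ hn k

variable {u : ℝ → V3} {a : V3}

theorem laminate_eq_integral (hσ : σ = 1 ∨ σ = -1) (hu : Continuous u)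
    (hu' : ∀ t, t ∉ range α → HasDerivAt u ((σ * (-1 : ℝ) ^ cnt m α t) • a) t) (t : ℝ) :
    u t = u 0 + ∫ s in (0 : ℝ)..t, (σ * (-1) ^ cnt m α s) • a := by
  have hphase : IntervalIntegrable (fun s => (σ * (-1) ^ cnt m α s) • a) volume 0 t :=
    (intervalIntegrable_const (c := ‖a‖)).mono_fun
      (measurable_phase σ α a).aestronglyMeasurable
      (Eventually.of_forall fun s => by simpa using norm_phase_le hσ a (cnt m α s))
  rw [integral_eq_of_hasDerivAt_off_countable u _ (finite_range α).countable hu.continuousOn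
    (fun s hs => hu' s hs.2) hphase, add_sub_cancel]

theorem tendsto_integral_ladder {Φ : ℝ → V3} (hc : Continuous Φ) (hΦ : IsTransition Φ a ℓ)
    (hσ : σ = 1 ∨ σ = -1) (hα : StrictMono α) (hε : ∀ n, 0 < ε n)
    (hε0 : Tendsto ε atTop (𝓝 0)) (hℓ : 0 ≤ ℓ) (hu : Continuous u)
    (hu' : ∀ t, t ∉ range α → HasDerivAt u ((σ * (-1 : ℝ) ^ cnt m α t) • a) t) (t : ℝ) :
    Tendsto (fun n => u 0 + ∫ s in (0 : ℝ)..t, ladder σ α (ε n) Φ a s) atTop (𝓝 (u t)) := by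
  obtain ⟨M, -, hM⟩ := hΦ.exists_bound hc
  rw [laminate_eq_integral hσ hu hu' t]
  refine tendsto_const_nhds.add ?_
  refine intervalIntegral.tendsto_integral_filter_of_dominated_convergence
    (fun _ => ‖σ • a + ∑ i : Fin m, interfaceSign σ i • a‖ + m * M) ?_ ?_
    intervalIntegrable_const ?_
  · exact Eventually.of_forall fun n => (ladder_continuous hc a).aestronglyMeasurable
  · exact Eventually.of_forall fun n => Eventually.of_forall fun s _ =>
      norm_ladder_le hσ (hε n) hM s
  · filter_upwards [(finite_range α).countable.ae_notMem volume] with s hs _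
    exact tendsto_const_nhds.congr'
      ((ladder_eventually_eq_phase hΦ hσ hα hε hε0 hℓ hs).mono fun n hn => hn.symm)

variable {ω : Set (ℝ × ℝ)} {h : ℕ → ℝ} {φ₁ φ₂ : ℝ → V3} {b : V3} {χ : ℝ → ℝ} {p : ℝ}

theorem abs_fst_le_of_mem_Om {R : ℝ} (hR : ∀ y ∈ ω, ‖y‖ ≤ R) {x : Pt} (hx : x ∈ Om ω) :
    |x.1| ≤ R :=
  (norm_fst_le (x.1, x.2.1)).trans (hR _ hx.1)

theorem volume_Om_ne_top (hωb : Bornology.IsBounded ω) : volume (Om ω) ≠ ⊤ := by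
  obtain ⟨R, hR⟩ := hωb.exists_norm_le
  have hsub : Om ω ⊆ Icc (-R) R ×ˢ (Icc (-R) R ×ˢ Icc (-1) 1) := fun x hx =>
    ⟨abs_le.1 (abs_fst_le_of_mem_Om hR hx),
      abs_le.1 ((norm_snd_le (x.1, x.2.1)).trans (hR _ hx.1)),
      by linarith [hx.2.1], by linarith [hx.2.2]⟩
  exact ((measure_mono hsub).trans_lt
    (isCompact_Icc.prod (isCompact_Icc.prod isCompact_Icc)).measure_lt_top).ne

theorem volume_slice_ne_top (hωb : Bornology.IsBounded ω) (s : ℝ) :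
    volume {t : ℝ | (s, t) ∈ ω} ≠ ⊤ := by
  obtain ⟨R, hR⟩ := hωb.exists_norm_le
  have hsub : {t : ℝ | (s, t) ∈ ω} ⊆ Icc (-R) R := fun t ht =>
    abs_le.1 ((norm_snd_le (s, t)).trans (hR _ ht))
  exact ((measure_mono hsub).trans_lt isCompact_Icc.measure_lt_top).ne

theorem abs_mul_le_of_mem_II {r z : ℝ} (hr : 0 ≤ r) (hz : z ∈ II) : |r * z| ≤ r := by
  rw [abs_mul, abs_of_nonneg hr]
  exact mul_le_of_le_one_right hr (abs_le.2 ⟨by linarith [hz.1], by linarith [hz.2]⟩)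

theorem tendsto_Lp_recoveryMap_sub (hωo : IsOpen ω) (hωb : Bornology.IsBounded ω)
    (hφ : IsProfile φ₁ φ₂ a b ℓ) (hχ : IsCutoff χ) (hσ : σ = 1 ∨ σ = -1) (hα : StrictMono α)
    (hh : ∀ n, 0 < h n) (hε : ∀ n, 0 < ε n) (hh0 : Tendsto h atTop (𝓝 0))
    (hε0 : Tendsto ε atTop (𝓝 0)) (hu : Continuous u)
    (hu' : ∀ t, t ∉ range α → HasDerivAt u ((σ * (-1 : ℝ) ^ cnt m α t) • a) t) (hp : 0 < p) :
    Tendsto (fun n => ∫⁻ x in Om ω, ENNReal.ofReal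
      (vnorm (recoveryMap σ α (ε n) (h n) χ φ₁ φ₂ a b (u 0) x - u x.1) ^ p)) atTop (𝓝 0) := by
  obtain ⟨R, hR⟩ := hωb.exists_norm_le
  obtain ⟨M₁, -, hM₁⟩ := hφ.transition₁.exists_bound hφ.contDiff₁.continuous
  obtain ⟨M₂, -, hM₂⟩ := hφ.transition₂.exists_bound hφ.contDiff₂.continuous
  obtain ⟨C, hC⟩ := (isCompact_Icc (a := -R) (b := R)).exists_bound_of_continuousOn
    hu.continuousOn
  set L₁ := ‖σ • a + ∑ i : Fin m, interfaceSign σ i • a‖ + m * M₁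
  set L₂ := ‖σ • b + ∑ i : Fin m, interfaceSign σ i • b‖ + m * M₂
  have hL₁ : ∀ n t, ‖ladder σ α (ε n) φ₁ a t‖ ≤ L₁ := fun n => norm_ladder_le hσ (hε n) hM₁
  have hL₂ : ∀ n t, ‖ladder σ α (ε n) φ₂ b t‖ ≤ L₂ := fun n => norm_ladder_le hσ (hε n) hM₂
  have hL₁0 : 0 ≤ L₁ := (norm_nonneg _).trans (hL₁ 0 0)
  have hL₂0 : 0 ≤ L₂ := (norm_nonneg _).trans (hL₂ 0 0)
  refine tendsto_lintegral_vnorm_rpow hp (isOpen_Om hωo).measurableSet (volume_Om_ne_top hωb)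
    (C := ‖u 0‖ + L₁ * R + 1 * L₂ + C)
    (fun n => ((recoveryMap_contDiff hφ hχ).continuous.sub
      (hu.comp continuous_fst)).measurable) ?_ ?_
  · filter_upwards [hh0.eventually_le_const one_pos] with n hn x hx
    have hx1 := abs_fst_le_of_mem_Om hR hx
    refine (norm_sub_le _ _).trans (add_le_add ?_ (hC _ (abs_le.1 hx1)))
    refine (norm_add_le _ _).trans (add_le_add ((norm_add_le _ _).trans ?_) ?_)
    · refine add_le_add le_rfl ?_
      have := intervalIntegral.norm_integral_le_of_norm_le_const (a := 0) (b := x.1)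
        fun s _ => hL₁ n s
      rw [sub_zero] at this
      exact this.trans (by gcongr)
    · rw [norm_smul, hχ.eqOn _ hx.2]
      have := abs_mul_le_of_mem_II (hh n).le hx.2
      exact mul_le_mul (this.trans hn) (hL₂ _ _) (norm_nonneg _) zero_le_one
  · refine Eventually.of_forall fun x hx => ?_
    have h1 := tendsto_integral_ladder hφ.contDiff₁.continuous hφ.transition₁ hσ hα hε hε0
      hφ.nonneg hu hu' x.1
    have h2 : Tendsto (fun n => (h n * χ x.2.2) • ladder σ α (ε n) φ₂ b x.1) atTop (𝓝 0) := by
      have hlim : Tendsto (fun n => h n * L₂) atTop (𝓝 0) := by simpa using hh0.mul_const L₂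
      refine squeeze_zero_norm (fun n => ?_) hlim
      rw [norm_smul, hχ.eqOn _ hx.2]
      exact mul_le_mul (abs_mul_le_of_mem_II (hh n).le hx.2) (hL₂ _ _) (norm_nonneg _) (hh n).le
    simpa [recoveryMap] using (h1.add h2).sub_const (u x.1)

theorem tendsto_Lp_pd_e1_recoveryMap (hωo : IsOpen ω) (hωb : Bornology.IsBounded ω)
    (hφ : IsProfile φ₁ φ₂ a b ℓ) (hχ : IsCutoff χ) (hσ : σ = 1 ∨ σ = -1) (hα : StrictMono α)
    (hh : ∀ n, 0 < h n) (hε : ∀ n, 0 < ε n) (hε0 : Tendsto ε atTop (𝓝 0))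
    (hr : Tendsto (fun n => h n / ε n) atTop (𝓝 0)) (v₀ : V3) (hp : 0 < p) :
    Tendsto (fun n => ∫⁻ x in Om ω, ENNReal.ofReal
      (vnorm (pd e1 (recoveryMap σ α (ε n) (h n) χ φ₁ φ₂ a b v₀) x
        - (σ * (-1 : ℝ) ^ cnt m α x.1) • a) ^ p)) atTop (𝓝 0) := by
  have d₂ := hφ.contDiff₂.two_hasDerivAt
  have z₂ : ∀ τ, ℓ < |τ| → deriv φ₂ τ = 0 := fun τ => hφ.transition₂.deriv_eq_zero
  obtain ⟨M₁, -, hM₁⟩ := hφ.transition₁.exists_bound hφ.contDiff₁.continuous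
  obtain ⟨M₂, hM₂0, hM₂⟩ := exists_bound_of_eq_zero d₂.2.2.1 z₂
  simp only [pd_e1_recoveryMap hφ hχ]
  refine tendsto_lintegral_vnorm_rpow hp (isOpen_Om hωo).measurableSet (volume_Om_ne_top hωb)
    (C := ‖σ • a + ∑ i : Fin m, interfaceSign σ i • a‖ + m * M₁ + m * M₂ + ‖a‖)
    (fun n => ?_) ?_ ?_
  · have k₁ : Continuous (ladder σ α (ε n) φ₁ a) := ladder_continuous hφ.contDiff₁.continuous a
    have k₂ : Continuous (layerSum σ α (ε n) 1 (deriv φ₂)) := layerSum_continuous d₂.2.2.1 1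
    have k₃ := hχ.contDiff.continuous
    refine Measurable.sub ?_ ((measurable_phase σ α a).comp measurable_fst)
    exact Continuous.measurable (by fun_prop)
  · filter_upwards [hr.eventually_le_const one_pos] with n hn x hx
    refine (norm_sub_le _ _).trans (add_le_add ?_ (norm_phase_le hσ a _))
    refine (norm_add_le _ _).trans (add_le_add (norm_ladder_le hσ (hε n) hM₁ _) ?_)
    rw [norm_smul, hχ.eqOn _ hx.2]
    calc _ ≤ h n * (m * ((ε n)⁻¹ ^ 1 * M₂)) :=
          mul_le_mul (abs_mul_le_of_mem_II (hh n).le hx.2) (norm_layerSum_le hσ (hε n) hM₂ 1 _)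
            (norm_nonneg _) (hh n).le
      _ = h n / ε n * (m * M₂) := by ring
      _ ≤ 1 * (m * M₂) := by gcongr
      _ = m * M₂ := one_mul _
  · filter_upwards [ae_fst_notMem_range α] with x hx _
    refine tendsto_const_nhds.congr' ?_
    filter_upwards [ladder_eventually_eq_phase hφ.transition₁ hσ hα hε hε0 hφ.nonneg hx,
      layerSum_eventually_eq_zero z₂ hσ hε hε0 1 hx] with n h1 h2
    rw [h1, h2, smul_zero, add_zero, sub_self]

theorem tendsLp_pd_e3_recoveryMap (hωo : IsOpen ω) (hωb : Bornology.IsBounded ω)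
    (hφ : IsProfile φ₁ φ₂ a b ℓ) (hχ : IsCutoff χ) (hσ : σ = 1 ∨ σ = -1) (hα : StrictMono α)
    (hh : ∀ n, 0 < h n) (hε : ∀ n, 0 < ε n) (hε0 : Tendsto ε atTop (𝓝 0)) (v₀ : V3)
    (hp : 0 < p) :
    TendsLp (Om ω) p
      (fun n x => (h n)⁻¹ • pd e3 (recoveryMap σ α (ε n) (h n) χ φ₁ φ₂ a b v₀) x)
      (fun x => (σ * (-1 : ℝ) ^ cnt m α x.1) • b) := by
  obtain ⟨M, -, hM⟩ := hφ.transition₂.exists_bound hφ.contDiff₂.continuous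
  have heq : ∀ n, ∀ x ∈ Om ω, (h n)⁻¹ • (h n * deriv χ x.2.2) • ladder σ α (ε n) φ₂ b x.1
      = ladder σ α (ε n) φ₂ b x.1 := fun n x hx => by
    rw [hχ.deriv_eqOn _ hx.2, mul_one, smul_smul, inv_mul_cancel₀ (hh n).ne', one_smul]
  unfold TendsLp
  simp only [pd_e3_recoveryMap hφ hχ]
  refine tendsto_lintegral_vnorm_rpow hp (isOpen_Om hωo).measurableSet (volume_Om_ne_top hωb)
    (C := ‖σ • b + ∑ i : Fin m, interfaceSign σ i • b‖ + m * M + ‖b‖)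
    (fun n => ?_) ?_ ?_
  · have k₁ : Continuous (ladder σ α (ε n) φ₂ b) := ladder_continuous hφ.contDiff₂.continuous b
    have k₂ := hχ.contDiff.two_hasDerivAt.2.2.1
    refine Measurable.sub ?_ ((measurable_phase σ α b).comp measurable_fst)
    exact Continuous.measurable (by fun_prop)
  · refine Eventually.of_forall fun n x hx => ?_
    rw [heq n x hx]
    exact (norm_sub_le _ _).trans
      (add_le_add (norm_ladder_le hσ (hε n) hM _) (norm_phase_le hσ b _))
  · filter_upwards [ae_fst_notMem_range α] with x hx hxΩ
    refine tendsto_const_nhds.congr' ?_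
    filter_upwards [ladder_eventually_eq_phase hφ.transition₂ hσ hα hε hε0 hφ.nonneg hx]
      with n h1
    rw [heq n x hxΩ, h1, sub_self]

theorem tendsto_Lp_recoveryMap (hωo : IsOpen ω) (hωb : Bornology.IsBounded ω)
    (hφ : IsProfile φ₁ φ₂ a b ℓ) (hχ : IsCutoff χ) (hσ : σ = 1 ∨ σ = -1) (hα : StrictMono α)
    (hh : ∀ n, 0 < h n) (hε : ∀ n, 0 < ε n) (hh0 : Tendsto h atTop (𝓝 0))
    (hε0 : Tendsto ε atTop (𝓝 0)) (hr : Tendsto (fun n => h n / ε n) atTop (𝓝 0))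
    (hu : Continuous u)
    (hu' : ∀ t, t ∉ range α → HasDerivAt u ((σ * (-1 : ℝ) ^ cnt m α t) • a) t) (hp : 0 < p) :
    Tendsto (fun n => ∫⁻ x in Om ω, ENNReal.ofReal
        (vnorm (recoveryMap σ α (ε n) (h n) χ φ₁ φ₂ a b (u 0) x - u x.1) ^ p
          + vnorm (pd e1 (recoveryMap σ α (ε n) (h n) χ φ₁ φ₂ a b (u 0)) x
            - (σ * (-1 : ℝ) ^ cnt m α x.1) • a) ^ p
          + vnorm (pd e2 (recoveryMap σ α (ε n) (h n) χ φ₁ φ₂ a b (u 0)) x) ^ p))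
      atTop (𝓝 0) := by
  have hsum := (tendsto_Lp_recoveryMap_sub hωo hωb hφ hχ hσ hα hh hε hh0 hε0 hu hu' hp).add
    (tendsto_Lp_pd_e1_recoveryMap hωo hωb hφ hχ hσ hα hh hε hε0 hr (u 0) hp)
  rw [add_zero] at hsum
  refine hsum.congr fun n => ?_
  have hmeas : Measurable fun x : Pt => ENNReal.ofReal
      (vnorm (recoveryMap σ α (ε n) (h n) χ φ₁ φ₂ a b (u 0) x - u x.1) ^ p) := by
    have hc := (recoveryMap_contDiff (σ := σ) (α := α) (ε := ε n) (h := h n) (v₀ := u 0)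
      hφ hχ).continuous.sub (hu.comp continuous_fst)
    exact (ENNReal.continuous_ofReal.comp
      ((continuous_vnorm.comp hc).rpow_const fun _ => Or.inr hp.le)).measurable
  rw [← lintegral_add_left hmeas]
  refine lintegral_congr fun x => ?_
  rw [pd_e2_recoveryMap hφ hχ, vnorm_zero, Real.zero_rpow hp.ne', add_zero,
    ENNReal.ofReal_add (Real.rpow_nonneg (vnorm_nonneg _) _)
      (Real.rpow_nonneg (vnorm_nonneg _) _)]

end LpConvergence

section Energy

variable {σ : ℝ} {m : ℕ} {α : Fin m → ℝ} {ε h : ℕ → ℝ} {ℓ : ℝ} {ω : Set (ℝ × ℝ)}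
  {φ₁ φ₂ : ℝ → V3} {a b : V3} {χ : ℝ → ℝ} {W : M33 → ℝ}

theorem tendsto_energy_recoveryMap (hW : Continuous W) (hW0 : ∀ ξ, 0 ≤ W ξ)
    (hw : VanishesAtWells W a b) (hωo : IsOpen ω) (hωc : Convex ℝ ω)
    (hωb : Bornology.IsBounded ω) (hslice : ∀ i, ∃ t, (α i, t) ∈ ω)
    (hφ : IsProfile φ₁ φ₂ a b ℓ) (hχ : IsCutoff χ) (hσ : σ = 1 ∨ σ = -1) (hα : StrictMono α)
    (hh : ∀ n, 0 < h n) (hε : ∀ n, 0 < ε n) (hε0 : Tendsto ε atTop (𝓝 0))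
    (hr : Tendsto (fun n => h n / ε n) atTop (𝓝 0)) (v₀ : V3) :
    Tendsto (fun n => F W (h n) (ε n) (recoveryMap σ α (ε n) (h n) χ φ₁ φ₂ a b v₀) (Om ω))
      atTop (𝓝 (profileEnergy W φ₁ φ₂ * ∑ i : Fin m, volume {t : ℝ | (α i, t) ∈ ω})) := by
  have hc := layerDensity_continuous hW hφ
  have hlayer : ∀ i : Fin m, Tendsto (fun n => ∫⁻ x in Om ω, ENNReal.ofReal ((ε n)⁻¹ *
      layerDensity W φ₁ φ₂
        (interfaceSign σ i * (h n / ε n), layerCoord σ α (ε n) i x.1, x.2.2))) atTop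
      (𝓝 (profileEnergy W φ₁ φ₂ * volume {t : ℝ | (α i, t) ∈ ω})) := by
    intro i
    have := tendsto_layer_energy hωo hωc hωb (hslice i) hc
      (fun q hq => layerDensity_eq_zero hw hφ hq) (fun τ z => by simp [layerDensity])
      (abs_interfaceSign hσ i) hε hε0 (r := fun n => interfaceSign σ i * (h n / ε n))
      (by simpa using hr.const_mul (interfaceSign σ i))
    simpa [layerDensity, profileEnergy, layerCoord] using this
  rw [Finset.mul_sum]
  refine (tendsto_finsetSum _ fun i _ => hlayer i).congr' ?_
  filter_upwards [eventually_separated hα hε0 ℓ] with n hn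
  rw [F, ← lintegral_finsetSum]
  · refine setLIntegral_congr_fun (isOpen_Om hωo).measurableSet fun x hx => ?_
    rw [energy_density_eq_sum hw hφ hχ hσ hα (hε n) (hh n).ne' hn hx.2,
      ENNReal.ofReal_sum_of_nonneg fun i _ =>
        mul_nonneg (inv_nonneg.2 (hε n).le) (layerDensity_nonneg hW0 _)]
  · intro i _
    have : Continuous fun x : Pt => (ε n)⁻¹ * layerDensity W φ₁ φ₂
        (interfaceSign σ i * (h n / ε n), layerCoord σ α (ε n) i x.1, x.2.2) := by
      unfold layerCoord
      fun_prop
    exact this.measurable.ennreal_ofReal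

end Energy

section Diagonal

/-- The limits of sequences selected from a sequence of sets form a closed set. -/
theorem exists_tendsto_of_mem_closure {X : Type*} [TopologicalSpace X]
    [TopologicalSpace.PseudoMetrizableSpace X] {S : ℕ → Set X} {x : X}
    (hx : x ∈ closure {z | ∃ y : ℕ → X, (∀ n, y n ∈ S n) ∧ Tendsto y atTop (𝓝 z)}) :
    ∃ y : ℕ → X, (∀ n, y n ∈ S n) ∧ Tendsto y atTop (𝓝 x) := by
  let := TopologicalSpace.pseudoMetrizableSpacePseudoMetric X
  have hne : ∀ n, (S n).Nonempty := by
    obtain ⟨z, y, hy, -⟩ := closure_nonempty_iff.1 ⟨x, hx⟩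
    exact fun n => ⟨y n, hy n⟩
  have hdist : Tendsto (fun n => Metric.infDist x (S n)) atTop (𝓝 0) := by
    rw [Metric.tendsto_atTop]
    intro δ hδ
    obtain ⟨z, ⟨y, hyS, hyz⟩, hz⟩ := Metric.mem_closure_iff.1 hx (δ / 2) (half_pos hδ)
    obtain ⟨N, hN⟩ := Metric.tendsto_atTop.1 hyz (δ / 2) (half_pos hδ)
    refine ⟨N, fun n hn => ?_⟩
    rw [Real.dist_0_eq_abs, abs_of_nonneg Metric.infDist_nonneg]
    calc Metric.infDist x (S n) ≤ dist x (y n) := Metric.infDist_le_dist_of_mem (hyS n)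
      _ ≤ dist x z + dist (y n) z := dist_triangle_right _ _ _
      _ < δ := by linarith [hN n hn]
  have hex : ∀ n : ℕ, ∃ y ∈ S n, dist x y < Metric.infDist x (S n) + 1 / ((n : ℝ) + 1) :=
    fun n => (Metric.infDist_lt_iff (hne n)).1 (lt_add_of_pos_right _ Nat.one_div_pos_of_nat)
  choose y hyS hy using hex
  refine ⟨y, hyS, tendsto_iff_dist_tendsto_zero.2 ?_⟩
  refine squeeze_zero (fun _ => dist_nonneg) (fun n => (dist_comm x (y n) ▸ hy n).le) ?_
  simpa using hdist.add tendsto_one_div_add_atTop_nhds_zero_nat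

end Diagonal

theorem Wells.vanishesAtWells {W : M33 → ℝ} {A B : M33} {a : V3} (h1 : H1 W A B)
    (hwells : Wells A B a) : VanishesAtWells W a (A 2) := by
  obtain ⟨hAB, rfl, hA⟩ := hwells
  have hA' : ![A 0, 0, A 2] = A := by
    funext i
    fin_cases i <;> simp [hA]
  have hB' : ![-A 0, 0, -A 2] = B := by
    rw [← neg_neg B, ← hAB]
    funext i
    fin_cases i <;> simp [hA]
  exact ⟨(h1.2.1 _).2 (Or.inl hA'), (h1.2.1 _).2 (Or.inr hB')⟩

/-- Theorem 5.6, recovery sequences in the subcritical regime,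
laminate case A' ≠ B'. -/
theorem statement14 (p : ℝ) (hp : 2 ≤ p) (A B : M33) (W : M33 → ℝ) (a : V3) (ha : a ≠ 0)
    (hWc : Continuous W) (h1 : H1 W A B) (h2 : H2 W p) (h3 : H3 W A B p) (h4 : H4 W)
    (hwells : Wells A B a)
    (ω : Set (ℝ × ℝ)) (hωo : IsOpen ω) (hωc : Convex ℝ ω)
    (hωb : Bornology.IsBounded ω) (hωne : ω.Nonempty)
    (m : ℕ) (hm : 0 < m) (α : Fin m → ℝ) (hαmono : StrictMono α)
    (hαin : ∀ i, sInf (Prod.fst '' ω) < α i ∧ α i < sSup (Prod.fst '' ω))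
    (σ : ℝ) (hσ : σ = 1 ∨ σ = -1)
    (ubar : ℝ → V3) (hubarc : Continuous ubar)
    (hubar : ∀ t, t ∉ Set.range α →
      HasDerivAt ubar ((σ * (-1 : ℝ) ^ (cnt m α t)) • a) t)
    (h ε : ℕ → ℝ) (hh : ∀ n, 0 < h n) (hε : ∀ n, 0 < ε n)
    (hh0 : Tendsto h atTop (nhds 0)) (hε0 : Tendsto ε atTop (nhds 0))
    (hratio : Tendsto (fun n => h n / ε n) atTop (nhds 0)) :
    ∃ un : ℕ → Pt → V3,
      (∀ n, ContDiff ℝ 1 (un n)) ∧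
      (∀ n, ∃ K : NNReal, LipschitzWith K (fderiv ℝ (un n))) ∧
      Tendsto (fun n => ∫⁻ x in Om ω, ENNReal.ofReal
          ((vnorm (un n x - ubar x.1)) ^ p
            + (vnorm (pd e1 (un n) x - (σ * (-1 : ℝ) ^ (cnt m α x.1)) • a)) ^ p
            + (vnorm (pd e2 (un n) x)) ^ p)) atTop (nhds 0) ∧
      TendsLp (Om ω) p (fun n x => (h n)⁻¹ • pd e3 (un n) x)
        (fun x => (σ * (-1 : ℝ) ^ (cnt m α x.1)) • A 2) ∧
      Tendsto (fun n => F W (h n) (ε n) (un n) (Om ω)) atTop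
        (nhds (K0 W a (A 2) * ∑ i : Fin m, volume {t : ℝ | (α i, t) ∈ ω})) := by
  have hw := hwells.vanishesAtWells h1
  have hp0 : 0 < p := two_pos.trans_le hp
  obtain ⟨χ, hχ⟩ := exists_isCutoff
  set V := ∑ i : Fin m, volume {t : ℝ | (α i, t) ∈ ω} with hV
  have hV_top : V ≠ ⊤ := ENNReal.sum_ne_top.2 fun i _ => volume_slice_ne_top hωb (α i)
  let errors : ℕ → (Pt → V3) → ℝ≥0∞ × ℝ≥0∞ × ℝ≥0∞ := fun n v =>
    (∫⁻ x in Om ω, ENNReal.ofReal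
        ((vnorm (v x - ubar x.1)) ^ p
          + (vnorm (pd e1 v x - (σ * (-1 : ℝ) ^ (cnt m α x.1)) • a)) ^ p
          + (vnorm (pd e2 v x)) ^ p),
      ∫⁻ x in Om ω, ENNReal.ofReal
        ((vnorm ((h n)⁻¹ • pd e3 v x - (σ * (-1 : ℝ) ^ (cnt m α x.1)) • A 2)) ^ p),
      F W (h n) (ε n) v (Om ω))
  let S : ℕ → Set (ℝ≥0∞ × ℝ≥0∞ × ℝ≥0∞) := fun n =>
    errors n '' {v | ContDiff ℝ 1 v ∧ ∃ K : ℝ≥0, LipschitzWith K (fderiv ℝ v)}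
  have hrecovery : ∀ E ∈ smoothEnergies W a (A 2) 2, ((0, 0, E * V) : ℝ≥0∞ × ℝ≥0∞ × ℝ≥0∞) ∈
      {z | ∃ y : ℕ → ℝ≥0∞ × ℝ≥0∞ × ℝ≥0∞, (∀ n, y n ∈ S n) ∧ Tendsto y atTop (𝓝 z)} := by
    rintro _ ⟨φ₁, φ₂, ℓ, -, -, c₁, c₂, -, -, t₁, t₂, rfl⟩
    have hφ : IsProfile φ₁ φ₂ a (A 2) (max ℓ 0) :=
      ⟨le_max_right _ _, c₁, c₂, t₁.mono (le_max_left _ _), t₂.mono (le_max_left _ _)⟩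
    refine ⟨fun n => errors n (recoveryMap σ α (ε n) (h n) χ φ₁ φ₂ a (A 2) (ubar 0)),
      fun n => mem_image_of_mem _ ⟨recoveryMap_contDiff hφ hχ,
        recoveryMap_fderiv_lipschitz hφ hχ hσ (hε n)⟩, ?_⟩
    exact (tendsto_Lp_recoveryMap hωo hωb hφ hχ hσ hαmono hh hε hh0 hε0 hratio hubarc hubar
      hp0).prodMk_nhds <|
      (tendsLp_pd_e3_recoveryMap hωo hωb hφ hχ hσ hαmono hh hε hε0 (ubar 0) hp0).prodMk_nhds <|
      tendsto_energy_recoveryMap hWc h1.1 hw hωo hωc hωb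
        (fun i => exists_mem_slice hωc hωne (hαin i)) hφ hχ hσ hαmono hh hε hε0 hratio (ubar 0)
  have hcont : Continuous fun E : ℝ≥0∞ => ((0, 0, E * V) : ℝ≥0∞ × ℝ≥0∞ × ℝ≥0∞) :=
    continuous_const.prodMk (continuous_const.prodMk (ENNReal.continuous_mul_const hV_top))
  obtain ⟨y, hyS, hy⟩ := exists_tendsto_of_mem_closure
    (map_mem_closure hcont (K0_mem_closure_smoothEnergies hWc hw) hrecovery)
  choose un hun hyun using hyS
  obtain rfl : (fun n => errors n (un n)) = y := funext hyun
  exact ⟨un, fun n => (hun n).1, fun n => (hun n).2, hy.fst_nhds, hy.snd_nhds.fst_nhds,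
    hy.snd_nhds.snd_nhds⟩
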